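/- Let m_1 ≤ ⋯ ≤ m_ℓ and n_1,…,n_r be positive integers with 1 ≤ p_i ≤ n_i for i = 1,…,r, and let ℤ/2 act on S^{n_1}×⋯×S^{n_r}×S^{m_1}×⋯×S^{m_ℓ} by the free involution acting as τ_{n_i,p_i} on the factor S^{n_i} and as the antipodal map on each factor S^{m_j}. Then cat_{ℤ/2}(S^{n_1}×⋯×S^{n_r}×S^{m_1}×⋯×S^{m_ℓ}) = m_1 + ℓ + r. -/

import Mathlib

open Set

namespace Paper

/-- The `ℤ/2`-space `(X, τ)` admits an equivariant categorical cover of size `k`: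
`X` is covered by `k` `τ`-invariant open sets, each of whose inclusions into `X`
is `ℤ/2`-equivariantly homotopic to a map taking values in a single orbit `{b, τ b}`. -/
def HasEqCatCover {X : Type*} [TopologicalSpace X] (τ : X → X) (k : ℕ) : Prop :=
  ∃ U : Fin k → Set X,
    (∀ i, IsOpen (U i)) ∧ (⋃ i, U i) = univ ∧ (∀ i, τ '' U i = U i) ∧
    ∀ i, ∃ (b : X) (H : C(↥(U i) × unitInterval, X)),
      (∀ u : U i, H (u, 0) = (u : X)) ∧
      (∀ u : U i, H (u, 1) ∈ ({b, τ b} : Set X)) ∧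
      ∀ (u : U i) (hu : τ (u : X) ∈ U i) (t : unitInterval),
        H (⟨τ (u : X), hu⟩, t) = τ (H (u, t))

/-- The equivariant Lusternik–Schnirelmann category of the `ℤ/2`-space `(X, τ)`,
as an extended natural number. -/
noncomputable def eqCat {X : Type*} [TopologicalSpace X] (τ : X → X) : ℕ∞ :=
  sInf {k : ℕ∞ | ∃ m : ℕ, k = m ∧ HasEqCatCover τ m}

/-- The unit sphere `S^n ⊂ ℝ^{n+1}`. -/
abbrev Sph (n : ℕ) : Type :=
  (Metric.sphere (0 : EuclideanSpace ℝ (Fin (n + 1))) 1 : Set (EuclideanSpace ℝ (Fin (n + 1))))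

/-- The linear isometry of `ℝ^{n+1}` fixing the first `p` coordinates and negating
the remaining ones. -/
noncomputable def tauLin (n p : ℕ) :
    EuclideanSpace ℝ (Fin (n + 1)) ≃ₗᵢ[ℝ] EuclideanSpace ℝ (Fin (n + 1)) :=
  LinearIsometryEquiv.piLpCongrRight 2
    (fun i : Fin (n + 1) => if (i : ℕ) < p then LinearIsometryEquiv.refl ℝ ℝ
      else LinearIsometryEquiv.neg ℝ)

/-- The involution `τ_{n,p}` of the sphere `S^n`:
`(y_1, …, y_{n+1}) ↦ (y_1, …, y_p, −y_{p+1}, …, −y_{n+1})`. -/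
noncomputable def tauSph (n p : ℕ) : Sph n → Sph n := fun x =>
  ⟨tauLin n p (x : EuclideanSpace ℝ (Fin (n + 1))), by
    have hx : ‖(x : EuclideanSpace ℝ (Fin (n + 1)))‖ = 1 :=
      mem_sphere_zero_iff_norm.mp x.2
    simp [mem_sphere_zero_iff_norm, (tauLin n p).norm_map, hx]⟩

/-- The antipodal involution of the sphere `S^n`. -/
noncomputable def negSph (n : ℕ) : Sph n → Sph n := fun x =>
  ⟨-(x : EuclideanSpace ℝ (Fin (n + 1))), by
    have hx : ‖(x : EuclideanSpace ℝ (Fin (n + 1)))‖ = 1 :=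
      mem_sphere_zero_iff_norm.mp x.2
    simp [mem_sphere_zero_iff_norm, hx]⟩

/-- A module of odd real dimension over a commutative real algebra gives a real character of the
algebra. -/
theorem nonempty_algHom_of_odd_finrank_module {A : Type*} [CommRing A] [Algebra ℝ A]
    (d : ℕ) : ∀ (M : Type*) [AddCommGroup M] [Module ℝ M] [Module A M] [IsScalarTower ℝ A M]
      [Module.Finite ℝ M], Module.finrank ℝ M = d → Odd d → Nonempty (A →ₐ[ℝ] ℝ) := by
  induction d using Nat.strong_induction_on with
  | _ d ih =>
    intro M _ _ _ _ _ hd hodd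
    have hnt : Nontrivial M := by
      apply Module.nontrivial_of_finrank_pos (R := ℝ)
      rw [hd]; exact hodd.pos
    by_cases hs : IsSimpleModule A M
    · obtain ⟨I, hI, ⟨e⟩⟩ := isSimpleModule_iff_quot_maximal.mp hs
      have e' : M ≃ₗ[ℝ] (A ⧸ I) := e.restrictScalars ℝ
      let : Field (A ⧸ I) := Ideal.Quotient.field I
      have : Module.Finite ℝ (A ⧸ I) := Module.Finite.equiv e'
      rcases Real.nonempty_algEquiv_or (A ⧸ I) with ⟨⟨f⟩⟩ | ⟨⟨f⟩⟩
      · exact ⟨f.toAlgHom.comp (Ideal.Quotient.mkₐ ℝ I)⟩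
      · have h2 : Module.finrank ℝ M = 2 := by
          rw [e'.finrank_eq, f.toLinearEquiv.finrank_eq, Complex.finrank_real_complex]
        rw [← hd, h2] at hodd
        exact absurd hodd (by decide)
    · have : ∃ N : Submodule A M, N ≠ ⊥ ∧ N ≠ ⊤ := by
        by_contra! hcon
        apply hs
        have : Nontrivial (Submodule A M) := (Submodule.nontrivial_iff A).mpr hnt
        rw [isSimpleModule_iff]
        exact ⟨fun N => or_iff_not_imp_left.mpr (hcon N)⟩
      obtain ⟨N, hb, ht⟩ := this
      have hsum := Submodule.finrank_quotient_add_finrank (N.restrictScalars ℝ)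
      have e1 : (M ⧸ N) ≃ₗ[ℝ] (M ⧸ N.restrictScalars ℝ) :=
        (Submodule.Quotient.restrictScalarsEquiv ℝ N).symm
      have e2 : N ≃ₗ[ℝ] (N.restrictScalars ℝ) := LinearEquiv.refl ℝ _
      have : Module.Finite ℝ (M ⧸ N) := Module.Finite.equiv e1.symm
      have : Module.Finite ℝ N := Module.Finite.equiv e2.symm
      rw [← e1.finrank_eq, ← e2.finrank_eq, hd] at hsum
      have hN : 0 < Module.finrank ℝ N := by
        have := (Submodule.nontrivial_iff_ne_bot).mpr hb
        exact Module.finrank_pos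
      have hQ : 0 < Module.finrank ℝ (M ⧸ N) := by
        have := Submodule.Quotient.nontrivial_iff.mpr ht
        exact Module.finrank_pos
      rcases Nat.even_or_odd (Module.finrank ℝ N) with he | ho
      · refine ih (Module.finrank ℝ (M ⧸ N)) (by omega) (M ⧸ N) rfl ?_
        rw [← hsum] at hodd
        exact (Nat.odd_add'.mp (by rwa [add_comm] at hodd)).mpr he
      · exact ih (Module.finrank ℝ N) (by omega) N rfl ho

/-- A linear perturbation by a scalar is bijective, off a countable set of scalars, if the space is
exhausted by invariant finite-dimensional subspaces. -/
theorem countable_setOf_not_bijective_add_smul {V : Type*} [AddCommGroup V] [Module ℝ V]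
    (R : ℕ → Submodule ℝ V) [∀ k, Module.Finite ℝ (R k)] (hR : ∀ v, ∃ k, v ∈ R k)
    (L : V →ₗ[ℝ] V) (hL : ∀ k, ∀ v ∈ R k, L v ∈ R k) :
    {ε : ℝ | ¬ Function.Bijective (L + ε • (LinearMap.id : V →ₗ[ℝ] V))}.Countable := by
  let T : ∀ k, Module.End ℝ (R k) := fun k => L.restrict (hL k)
  have hc : (⋃ k, {ε : ℝ | (T k).HasEigenvalue (-ε)}).Countable := by
    refine countable_iUnion fun k => ?_
    have := ((T k).finite_hasEigenvalue).countable
    exact this.preimage neg_injective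
  refine hc.mono fun ε hε => ?_
  by_contra hcon
  apply hε
  simp only [mem_iUnion, mem_setOf_eq, not_exists] at hcon
  have hinj : ∀ k, Function.Injective (T k + ε • (LinearMap.id : R k →ₗ[ℝ] R k)) := by
    intro k
    rw [← LinearMap.ker_eq_bot, LinearMap.ker_eq_bot']
    intro v hv
    by_contra hne
    apply hcon k
    refine Module.End.hasEigenvalue_of_hasEigenvector (x := v) ⟨?_, hne⟩
    rw [Module.End.mem_eigenspace_iff]
    have : T k v + ε • v = 0 := hv
    rw [neg_smul]; exact eq_neg_of_add_eq_zero_left this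
  constructor
  · rw [← LinearMap.ker_eq_bot, LinearMap.ker_eq_bot']
    intro v hv
    obtain ⟨k, hk⟩ := hR v
    have : (⟨v, hk⟩ : R k) = 0 := by
      apply hinj k
      rw [map_zero]
      exact Subtype.ext hv
    exact congrArg Subtype.val this
  · intro v
    obtain ⟨k, hk⟩ := hR v
    obtain ⟨u, hu⟩ := (LinearMap.injective_iff_surjective.mp (hinj k)) ⟨v, hk⟩
    exact ⟨u, congrArg Subtype.val hu⟩

section Polynomials

open MvPolynomial

/-- Polynomials of weighted degree at most `k`. -/
noncomputable abbrev wdegLE {κ : Type*} (w : κ → ℕ) (k : ℕ) : Submodule ℝ (MvPolynomial κ ℝ) :=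
  restrictSupport ℝ {α : κ →₀ ℕ | Finsupp.weight w α ≤ k}

theorem wdegLE_mono {κ : Type*} (w : κ → ℕ) {k l : ℕ} (h : k ≤ l) : wdegLE w k ≤ wdegLE w l :=
  restrictSupport_mono ℝ fun _ ha => le_trans ha h

theorem mul_mem_wdegLE {κ : Type*} {w : κ → ℕ} {k l : ℕ} {f g : MvPolynomial κ ℝ}
    (hf : f ∈ wdegLE w k) (hg : g ∈ wdegLE w l) : f * g ∈ wdegLE w (k + l) := by
  have h := Submodule.mul_mem_mul hf hg
  rw [wdegLE, wdegLE, ← restrictSupport_add] at h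
  refine restrictSupport_mono ℝ ?_ h
  rintro _ ⟨a, ha, b, hb, rfl⟩
  simp only [mem_ofPred_eq, map_add] at *
  exact add_le_add ha hb

theorem monomial_mem_wdegLE {κ : Type*} {w : κ → ℕ} {k : ℕ} {α : κ →₀ ℕ} {c : ℝ}
    (h : Finsupp.weight w α ≤ k) : monomial α c ∈ wdegLE w k :=
  (monomial_mem_restrictSupport ℝ).mpr (Or.inl h)

theorem finite_wdegLE {κ : Type*} [Finite κ] {w : κ → ℕ} (hw : ∀ i, w i ≠ 0) (k : ℕ) :
    Module.Finite ℝ (wdegLE w k) := by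
  have hfin : {α : κ →₀ ℕ | Finsupp.weight w α ≤ k}.Finite :=
    Finsupp.finite_of_nat_weight_le w hw k
  have := hfin.to_subtype
  exact Module.Finite.of_basis (basisRestrictSupport ℝ _)

/-- The rewriting step attached to a selection rule `φ`: a monomial `x ^ α` from which `φ` selects
the variable `j` is sent to `f j * x ^ (α - q j)`, the other monomials are killed. -/
noncomputable def rewriteStep {κ : Type*} (q : κ → ℕ) (f : κ → MvPolynomial κ ℝ)
    (φ : (κ →₀ ℕ) → Option κ) : MvPolynomial κ ℝ →ₗ[ℝ] MvPolynomial κ ℝ :=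
  (basisMonomials κ ℝ).constr ℝ fun α =>
    (φ α).elim 0 fun j => f j * monomial (α - Finsupp.single j (q j)) 1

theorem rewriteStep_monomial {κ : Type*} (q : κ → ℕ) (f : κ → MvPolynomial κ ℝ)
    (φ : (κ →₀ ℕ) → Option κ) (α : κ →₀ ℕ) :
    rewriteStep q f φ (monomial α 1) =
      (φ α).elim 0 fun j => f j * monomial (α - Finsupp.single j (q j)) 1 := by
  have := (basisMonomials κ ℝ).constr_basis ℝ (fun α =>
    (φ α).elim 0 fun j => f j * monomial (α - Finsupp.single j (q j)) 1) α
  rwa [coe_basisMonomials] at this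

theorem rewriteStep_mem_wdegLE {κ : Type*} {w q : κ → ℕ} {f : κ → MvPolynomial κ ℝ}
    (hf : ∀ j, f j ∈ wdegLE w (w j * q j)) {φ : (κ →₀ ℕ) → Option κ}
    (hφ : ∀ α j, φ α = some j → q j ≤ α j) {k : ℕ} {v : MvPolynomial κ ℝ} (hv : v ∈ wdegLE w k) :
    rewriteStep q f φ v ∈ wdegLE w k := by
  have : wdegLE w k ≤ (wdegLE w k).comap (rewriteStep q f φ) := by
    rw [wdegLE, restrictSupport_eq_span, Submodule.span_le]
    rintro _ ⟨α, hα, rfl⟩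
    rw [SetLike.mem_coe, Submodule.mem_comap, ← restrictSupport_eq_span]
    simp only
    rw [rewriteStep_monomial]
    rcases h : φ α with _ | j
    · exact Submodule.zero_mem _
    · have hle : Finsupp.single j (q j) ≤ α := by
        rw [Finsupp.single_le_iff]; exact hφ α j h
      have hsum : Finsupp.weight w α
          = Finsupp.weight w (α - Finsupp.single j (q j)) + q j * w j := by
        conv_lhs => rw [← tsub_add_cancel_of_le hle]
        rw [map_add, Finsupp.weight_single, smul_eq_mul]
      have hα' : Finsupp.weight w α ≤ k := hα
      refine wdegLE_mono w ?_ (mul_mem_wdegLE (hf j)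
        (monomial_mem_wdegLE (c := 1) (le_refl (Finsupp.weight w (α - Finsupp.single j (q j))))))
      rw [mul_comm (w j)]; omega
  exact this hv

/-- The system perturbed by pure powers. -/
noncomputable def perturb {κ : Type*} (q : κ → ℕ) (f : κ → MvPolynomial κ ℝ) (ε : ℝ) (j : κ) :
    MvPolynomial κ ℝ :=
  f j + C ε * X j ^ q j

/-- The scalar perturbation of the rewriting step. -/
noncomputable def rewriteMap {κ : Type*} (q : κ → ℕ) (f : κ → MvPolynomial κ ℝ)
    (φ : (κ →₀ ℕ) → Option κ) (ε : ℝ) : MvPolynomial κ ℝ →ₗ[ℝ] MvPolynomial κ ℝ :=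
  rewriteStep q f φ + ε • (LinearMap.id : MvPolynomial κ ℝ →ₗ[ℝ] MvPolynomial κ ℝ)

theorem rewriteMap_monomial_none {κ : Type*} (q : κ → ℕ) (f : κ → MvPolynomial κ ℝ)
    (φ : (κ →₀ ℕ) → Option κ) (ε : ℝ) {α : κ →₀ ℕ} (h : φ α = none) :
    (rewriteMap q f φ ε) (monomial α 1) = ε • monomial α 1 := by
  rw [rewriteMap, LinearMap.add_apply, rewriteStep_monomial, h]
  simp

theorem rewriteMap_monomial_some {κ : Type*} (q : κ → ℕ) (f : κ → MvPolynomial κ ℝ)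
    (φ : (κ →₀ ℕ) → Option κ) (ε : ℝ) {α : κ →₀ ℕ} {j : κ} (h : φ α = some j) (hq : q j ≤ α j) :
    (rewriteMap q f φ ε) (monomial α 1) =
      perturb q f ε j * monomial (α - Finsupp.single j (q j)) 1 := by
  have hle : Finsupp.single j (q j) ≤ α := by rw [Finsupp.single_le_iff]; exact hq
  rw [rewriteMap, LinearMap.add_apply, rewriteStep_monomial, h, perturb, add_mul, mul_assoc, X_pow_eq_monomial,
    monomial_mul, add_tsub_cancel_of_le hle]
  simp [smul_monomial, C_mul_monomial]

/-- For all but countably many perturbation parameters, the ideal of the perturbed system is the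
bijective image of a span of monomials. -/
theorem exists_rewrite_rule {κ : Type*} [Finite κ] {w q : κ → ℕ} (hw : ∀ i, w i ≠ 0)
    {f : κ → MvPolynomial κ ℝ} (hf : ∀ j, f j ∈ wdegLE w (w j * q j)) (s : Finset κ) :
    ∃ (φ : (κ →₀ ℕ) → Option κ) (S : Set ℝ), S.Countable ∧
      (∀ α, φ α = none ↔ ∀ j ∈ s, α j < q j) ∧ (∀ α j, φ α = some j → q j ≤ α j ∧ j ∈ s) ∧
      ∀ ε ∉ S, Function.Bijective (rewriteMap q f φ ε) ∧
        ((Ideal.span (perturb q f ε '' s)).restrictScalars ℝ : Submodule ℝ (MvPolynomial κ ℝ)) =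
        (restrictSupport ℝ {α | φ α ≠ none}).map
          (rewriteMap q f φ ε) := by
  classical
  have hfin := finite_wdegLE hw
  have hex : ∀ v : MvPolynomial κ ℝ, ∃ k, v ∈ wdegLE w k := fun v =>
    ⟨v.support.sup (Finsupp.weight w), fun α hα => Finset.le_sup (f := Finsupp.weight w) hα⟩
  have bad : ∀ φ : (κ →₀ ℕ) → Option κ, (∀ α j, φ α = some j → q j ≤ α j) →
      {ε : ℝ | ¬ Function.Bijective
        (rewriteMap q f φ ε)}.Countable := fun φ hφ =>
    countable_setOf_not_bijective_add_smul (wdegLE w) hex _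
      fun k v hv => rewriteStep_mem_wdegLE hf hφ hv
  induction s using Finset.induction with
  | empty =>
    refine ⟨fun _ => none, _, bad (fun _ => none) (by simp), by simp, by simp, fun ε hε => ⟨?_, ?_⟩⟩
    · simpa using hε
    · have : {α : κ →₀ ℕ | (none : Option κ) ≠ none} = ∅ := by ext; simp
      rw [this, restrictSupport_eq_span]
      simp
  | insert i s hi ih =>
    obtain ⟨φ, S, hS, h1, h2, h3⟩ := ih
    let ψ : (κ →₀ ℕ) → Option κ := fun α =>
      if φ α = none then (if q i ≤ α i then some i else none) else φ α
    have hψ1 : ∀ α, ψ α = none ↔ ∀ j ∈ insert i s, α j < q j := by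
      intro α
      simp only [ψ, Finset.forall_mem_insert, ← h1]
      by_cases h : φ α = none <;> by_cases h' : q i ≤ α i <;> (simp [h, h']; try omega)
    have hψ2 : ∀ α j, ψ α = some j → q j ≤ α j ∧ j ∈ insert i s := by
      intro α j
      simp only [ψ]
      by_cases h : φ α = none
      · by_cases h' : q i ≤ α i
        · simp only [h, h', if_true, Option.some.injEq]
          rintro rfl
          exact ⟨h', Finset.mem_insert_self _ _⟩
        · simp [h, h']
      · simp only [h, if_false]
        intro hj
        exact ⟨(h2 α j hj).1, Finset.mem_insert_of_mem (h2 α j hj).2⟩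
    have hψφ : ∀ α, φ α ≠ none → ψ α = φ α := fun α h => by simp [ψ, h]
    refine ⟨ψ, S ∪ _, hS.union (bad ψ fun α j h => (hψ2 α j h).1), hψ1, hψ2, fun ε hε => ?_⟩
    rw [mem_union, not_or] at hε
    obtain ⟨hεS, hεψ⟩ := hε
    have hbij := not_not.mp hεψ
    obtain ⟨hbφ, hIφ⟩ := h3 ε hεS
    refine ⟨hbij, ?_⟩
    set Lφ := rewriteMap q f φ ε with hLφ
    set Lψ := rewriteMap q f ψ ε with hLψ
    have hsub : (Ideal.span (perturb q f ε '' s)).restrictScalars ℝ ≤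
        (restrictSupport ℝ {α | ψ α ≠ none}).map Lψ := by
      rw [hIφ, restrictSupport_eq_span, Submodule.map_span_le]
      rintro _ ⟨α, hα, rfl⟩
      refine ⟨monomial α 1, monomial_mem_restrictSupport ℝ |>.mpr (Or.inl ?_), ?_⟩
      · have hα' : φ α ≠ none := hα
        simpa [hψφ α hα'] using hα'
      · obtain ⟨j, hj⟩ := Option.ne_none_iff_exists'.mp hα
        simp only
        rw [hLφ, hLψ, rewriteMap_monomial_some q f φ ε hj (h2 α j hj).1,
          rewriteMap_monomial_some q f ψ ε ((hψφ α hα).trans hj) (h2 α j hj).1]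
    apply le_antisymm
    · intro p hp
      have hp' : p ∈ Ideal.span (perturb q f ε '' (insert i s : Finset κ)) := hp
      rw [Finset.coe_insert, image_insert_eq, Ideal.mem_span_insert] at hp'
      obtain ⟨r, z, hz, rfl⟩ := hp'
      refine Submodule.add_mem _ ?_ (hsub hz)
      obtain ⟨r', rfl⟩ := hbφ.2 r
      clear hp
      have hr' : r' ∈ Submodule.span ℝ ((monomial · (1 : ℝ)) '' (univ : Set (κ →₀ ℕ))) := by
        rw [← restrictSupport_eq_span, restrictSupport_univ]; trivial
      induction hr' using Submodule.span_induction with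
      | zero => simp
      | add x y _ _ hx hy => rw [map_add, add_mul]; exact Submodule.add_mem _ hx hy
      | smul a x _ hx => rw [map_smul, smul_mul_assoc]; exact Submodule.smul_mem _ a hx
      | mem x hx =>
        obtain ⟨α, -, rfl⟩ := hx
        simp only
        rcases hα : φ α with _ | j
        · have hqi : q i ≤ (α + Finsupp.single i (q i)) i := by simp
          have hnone : φ (α + Finsupp.single i (q i)) = none := by
            rw [h1]
            intro j hj
            have hij : i ≠ j := fun h => hi (h ▸ hj)
            simpa [Finsupp.single_apply, hij] using (h1 α).mp hα j hj
          have hsome : ψ (α + Finsupp.single i (q i)) = some i := by simp [ψ, hnone]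
          rw [hLφ, rewriteMap_monomial_none q f φ ε hα, smul_mul_assoc]
          refine Submodule.smul_mem _ ε ⟨monomial (α + Finsupp.single i (q i)) 1,
            (monomial_mem_restrictSupport ℝ).mpr (Or.inl ?_), ?_⟩
          · simp [hsome]
          · rw [hLψ, rewriteMap_monomial_some q f ψ ε hsome hqi, add_tsub_cancel_right, mul_comm]
        · apply hsub
          rw [hLφ, rewriteMap_monomial_some q f φ ε hα (h2 α j hα).1]
          have : perturb q f ε j ∈ Ideal.span (perturb q f ε '' s) :=
            Ideal.subset_span (mem_image_of_mem _ (Finset.mem_coe.mpr (h2 α j hα).2))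
          exact Ideal.mul_mem_right _ _ (Ideal.mul_mem_right _ _ this)
    · rw [restrictSupport_eq_span, Submodule.map_span_le]
      rintro _ ⟨α, hα, rfl⟩
      obtain ⟨j, hj⟩ := Option.ne_none_iff_exists'.mp hα
      simp only
      rw [hLψ, rewriteMap_monomial_some q f ψ ε hj (hψ2 α j hj).1]
      exact Ideal.mul_mem_right _ _
        (Ideal.subset_span (mem_image_of_mem _ (Finset.mem_coe.mpr (hψ2 α j hj).2)))

theorem isCompl_restrictSupport_compl {κ : Type*} (T : Set (κ →₀ ℕ)) :
    IsCompl (restrictSupport ℝ T) (restrictSupport ℝ Tᶜ) := by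
  constructor
  · rw [Submodule.disjoint_def]
    intro p h1 h2
    rw [mem_restrictSupport_iff] at h1 h2
    rw [← support_eq_empty, ← Finset.coe_eq_empty]
    exact subset_eq_empty (subset_inter h1 h2) (inter_compl_self T)
  · rw [codisjoint_iff, eq_top_iff, ← restrictSupport_univ, restrictSupport_eq_span,
      Submodule.span_le]
    rintro _ ⟨α, -, rfl⟩
    by_cases h : α ∈ T
    · exact Submodule.mem_sup_left ((monomial_mem_restrictSupport ℝ).mpr (Or.inl h))
    · exact Submodule.mem_sup_right ((monomial_mem_restrictSupport ℝ).mpr (Or.inl h))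

theorem card_setOf_forall_lt {κ : Type*} [Fintype κ] (q : κ → ℕ) :
    Nat.card {α : κ →₀ ℕ | ∀ j, α j < q j} = ∏ j, q j := by
  let e : {α : κ →₀ ℕ | ∀ j, α j < q j} ≃ ∀ j, Fin (q j) :=
    { toFun := fun α j => ⟨α.1 j, α.2 j⟩
      invFun := fun β => ⟨Finsupp.equivFunOnFinite.symm fun j => (β j : ℕ), fun j => by simp⟩
      left_inv := fun α => by ext; simp
      right_inv := fun β => by ext; simp }
  rw [Nat.card_congr e, Nat.card_pi]
  simp

/-- A real system whose `j`-th equation has weighted degree at most `w j * q j`, `q j` odd, acquires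
a real solution after adding `ε * x_j ^ q j` to the `j`-th equation, for all but countably many
`ε`. -/
theorem exists_real_zero_perturb {κ : Type*} [Finite κ] {w q : κ → ℕ} (hw : ∀ i, w i ≠ 0)
    (hq : ∀ j, Odd (q j)) {f : κ → MvPolynomial κ ℝ} (hf : ∀ j, f j ∈ wdegLE w (w j * q j)) :
    ∃ S : Set ℝ, S.Countable ∧ ∀ ε ∉ S, ∃ x : κ → ℝ, ∀ j, eval x (f j) + ε * x j ^ q j = 0 := by
  have := Fintype.ofFinite κ
  obtain ⟨φ, S, hS, h1, -, h3⟩ := exists_rewrite_rule hw hf Finset.univ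
  refine ⟨S, hS, fun ε hε => ?_⟩
  obtain ⟨hbij, hI⟩ := h3 ε hε
  set I := Ideal.span (perturb q f ε '' (Finset.univ : Finset κ)) with hIdef
  set T : Set (κ →₀ ℕ) := {α | φ α ≠ none} with hT
  have hTc : Tᶜ = {α : κ →₀ ℕ | ∀ j, α j < q j} := by
    ext α; simp [hT, h1]
  let e1 : (MvPolynomial κ ℝ ⧸ restrictSupport ℝ T) ≃ₗ[ℝ]
      (MvPolynomial κ ℝ ⧸ I.restrictScalars ℝ) :=
    Submodule.Quotient.equiv _ _ (LinearEquiv.ofBijective _ hbij) hI.symm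
  let e2 : (MvPolynomial κ ℝ ⧸ I) ≃ₗ[ℝ] (restrictSupport ℝ Tᶜ) :=
    (Submodule.Quotient.restrictScalarsEquiv ℝ I).symm ≪≫ₗ e1.symm ≪≫ₗ
      Submodule.quotientEquivOfIsCompl _ _ (isCompl_restrictSupport_compl T)
  have hcard : Nat.card (Tᶜ : Set (κ →₀ ℕ)) = ∏ j, q j := by
    rw [hTc]; exact card_setOf_forall_lt q
  have hpos : ∏ j, q j ≠ 0 := Finset.prod_ne_zero_iff.mpr fun j _ => (hq j).pos.ne'
  have hfinT : Finite (Tᶜ : Set (κ →₀ ℕ)) := Nat.finite_of_card_ne_zero (hcard ▸ hpos)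
  have hfin : Module.Finite ℝ (restrictSupport ℝ Tᶜ) :=
    Module.Finite.of_basis (basisRestrictSupport ℝ _)
  have hfin' : Module.Finite ℝ (MvPolynomial κ ℝ ⧸ I) := Module.Finite.equiv e2.symm
  have hrank : Module.finrank ℝ (MvPolynomial κ ℝ ⧸ I) = ∏ j, q j := by
    rw [e2.finrank_eq, Module.finrank_eq_nat_card_basis (basisRestrictSupport ℝ _), hcard]
  have hodd : Odd (∏ j, q j) := by
    apply Finset.prod_induction _ Odd (fun _ _ => Odd.mul) odd_one fun j _ => hq j
  obtain ⟨χ⟩ := nonempty_algHom_of_odd_finrank_module (A := MvPolynomial κ ℝ ⧸ I) _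
    (MvPolynomial κ ℝ ⧸ I) hrank hodd
  let ψ : MvPolynomial κ ℝ →ₐ[ℝ] ℝ := χ.comp (Ideal.Quotient.mkₐ ℝ I)
  refine ⟨fun j => ψ (X j), fun j => ?_⟩
  have hz : ψ (perturb q f ε j) = 0 := by
    have : perturb q f ε j ∈ I := Ideal.subset_span (mem_image_of_mem _ (by simp))
    simp only [ψ, AlgHom.comp_apply, Ideal.Quotient.mkₐ_eq_mk]
    rw [Ideal.Quotient.eq_zero_iff_mem.mpr this, map_zero]
  have hev : ∀ p : MvPolynomial κ ℝ, ψ p = eval (fun j => ψ (X j)) p := by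
    intro p
    conv_lhs => rw [aeval_unique ψ]
    rw [← coe_aeval_eq_eval]; rfl
  rw [hev] at hz
  simpa [perturb] using hz

/-- Weights on the homogenized variables: the homogenizing variable and the variables in `Fin m`
have weight one. -/
def homWeight {m : ℕ} {ι : Type*} (w : ι → ℕ) : Option (Fin m ⊕ ι) → ℕ :=
  fun v => v.elim 1 (Sum.elim (fun _ => 1) w)

/-- The involution changing the sign of the variables of odd weight. -/
def signFlip {κ : Type*} (w : κ → ℕ) (z : κ → ℝ) : κ → ℝ := fun v => (-1) ^ w v * z v

theorem eval_signFlip_monomial {κ : Type*} [Fintype κ] (w : κ → ℕ) (z : κ → ℝ) (α : κ →₀ ℕ) :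
    eval (signFlip w z) (monomial α 1) =
      (-1) ^ Finsupp.weight w α * eval z (monomial α (1 : ℝ)) := by
  rw [eval_monomial, eval_monomial, Finsupp.prod_fintype _ _ (by simp),
    Finsupp.prod_fintype _ _ (by simp), Finsupp.weight_apply, Finsupp.sum_fintype _ _ (by simp)]
  simp only [signFlip, mul_pow, Finset.prod_mul_distrib, ← pow_mul, Finset.prod_pow_eq_pow_sum,
    smul_eq_mul, one_mul]
  simp_rw [mul_comm]

/-- The point of the cylinder `{z | z₀² + ∑ zᵢ² = 1}` with affine coordinates `x`. -/
noncomputable def cylPoint {m : ℕ} {ι : Type*} (w : ι → ℕ) (x : Fin m ⊕ ι → ℝ) :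
    Option (Fin m ⊕ ι) → ℝ :=
  fun v => v.elim (√(1 + ∑ i, x (Sum.inl i) ^ 2))⁻¹
    fun k => x k / √(1 + ∑ i, x (Sum.inl i) ^ 2) ^ homWeight w (some k)

theorem pow_mem_wdegLE {κ : Type*} {w : κ → ℕ} {k : ℕ} {f : MvPolynomial κ ℝ}
    (hf : f ∈ wdegLE w k) (n : ℕ) : f ^ n ∈ wdegLE w (k * n) := by
  induction n with
  | zero => exact monomial_mem_wdegLE (c := 1) (by simp)
  | succ n ih => rw [pow_succ, mul_add, mul_one]; exact mul_mem_wdegLE ih hf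

/-- Homogenization of the part of `p` with the parity of `d`, restricted to an affine chart. -/
theorem exists_dehomogenization {m : ℕ} {ι : Type*} [Fintype ι] (w : ι → ℕ) (d : ℕ)
    {p : MvPolynomial (Option (Fin m ⊕ ι)) ℝ} (hp : p ∈ wdegLE (homWeight w) d) :
    ∃ f ∈ wdegLE (fun k : Fin m ⊕ ι => homWeight w (some k)) d, ∀ x : Fin m ⊕ ι → ℝ,
      eval x f = √(1 + ∑ i, x (Sum.inl i) ^ 2) ^ d * ((eval (cylPoint w x) p +
        (-1) ^ d * eval (signFlip (homWeight w) (cylPoint w x)) p) / 2) := by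
  rw [wdegLE, restrictSupport_eq_span] at hp
  induction hp using Submodule.span_induction with
  | zero => exact ⟨0, Submodule.zero_mem _, by simp⟩
  | add p q _ _ hp hq =>
    obtain ⟨f, hf, hf'⟩ := hp
    obtain ⟨g, hg, hg'⟩ := hq
    refine ⟨f + g, Submodule.add_mem _ hf hg, fun x => ?_⟩
    rw [map_add, hf', hg', map_add, map_add]; ring
  | smul a p _ hp =>
    obtain ⟨f, hf, hf'⟩ := hp
    refine ⟨a • f, Submodule.smul_mem _ a hf, fun x => ?_⟩
    rw [smul_eval, hf', smul_eval, smul_eval]; ring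
  | mem p hp =>
    obtain ⟨α, hα, rfl⟩ := hp
    have hα : Finsupp.weight (homWeight w) α ≤ d := hα
    simp only [eval_signFlip_monomial]
    have hwt : Finsupp.weight (homWeight w) α = α none +
        Finsupp.weight (fun k : Fin m ⊕ ι => homWeight w (some k)) α.some := by
      rw [Finsupp.weight_apply, Finsupp.sum_fintype _ _ (by simp), Fintype.sum_option,
        Finsupp.weight_apply, Finsupp.sum_fintype _ _ (by simp)]
      simp [homWeight]
    rcases Nat.even_or_odd (d - Finsupp.weight (homWeight w) α) with he | ho
    · obtain ⟨c, hc⟩ := he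
      have hd : d = Finsupp.weight (homWeight w) α + 2 * c := by omega
      have hs : (1 + ∑ i : Fin m, X (Sum.inl i) ^ 2 : MvPolynomial (Fin m ⊕ ι) ℝ) ∈
          wdegLE (fun k : Fin m ⊕ ι => homWeight w (some k)) 2 := by
        refine Submodule.add_mem _ (monomial_mem_wdegLE (by simp)) (Submodule.sum_mem _ ?_)
        intro i _
        rw [X_pow_eq_monomial]
        exact monomial_mem_wdegLE (by simp [Finsupp.weight_single, homWeight])
      refine ⟨monomial α.some 1 * (1 + ∑ i : Fin m, X (Sum.inl i) ^ 2) ^ c, ?_, fun x => ?_⟩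
      · refine wdegLE_mono _ ?_ (mul_mem_wdegLE (monomial_mem_wdegLE le_rfl) (pow_mem_wdegLE hs c))
        omega
      · set ρ := √(1 + ∑ i, x (Sum.inl i) ^ 2) with hρ
        have hpos : 0 < 1 + ∑ i : Fin m, x (Sum.inl i) ^ 2 := by positivity
        have hρ0 : ρ ≠ 0 := (Real.sqrt_pos.mpr hpos).ne'
        have hρ2 : 1 + ∑ i : Fin m, x (Sum.inl i) ^ 2 = ρ ^ 2 := (Real.sq_sqrt hpos.le).symm
        have hsign : (-1 : ℝ) ^ d * (-1) ^ Finsupp.weight (homWeight w) α = 1 := by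
          rw [← pow_add, Even.neg_one_pow]
          rw [hd]; exact ⟨Finsupp.weight (homWeight w) α + c, by ring⟩
        rw [← mul_assoc, hsign, one_mul, add_self_div_two]
        rw [eval_mul, eval_monomial, eval_monomial, Finsupp.prod_fintype _ _ (by simp),
          Finsupp.prod_fintype _ _ (by simp), Fintype.prod_option]
        simp only [cylPoint, Option.elim, ← hρ, inv_pow, div_pow, Finset.prod_div_distrib, ← pow_mul,
          Finset.prod_pow_eq_pow_sum]
        have hw' : ∑ k : Fin m ⊕ ι, homWeight w (some k) * α (some k) =
            Finsupp.weight (fun k : Fin m ⊕ ι => homWeight w (some k)) α.some := by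
          rw [Finsupp.weight_apply, Finsupp.sum_fintype _ _ (by simp)]
          simp [mul_comm]
        rw [hw', hd, hwt]
        simp only [map_pow, map_add, map_one, map_sum, eval_X, hρ2, Finsupp.some_apply]
        field_simp
        ring
    · refine ⟨0, Submodule.zero_mem _, fun x => ?_⟩
      have hsign : (-1 : ℝ) ^ d * (-1) ^ Finsupp.weight (homWeight w) α = -1 := by
        rw [← pow_add, Odd.neg_one_pow]
        have : d + Finsupp.weight (homWeight w) α =
          (d - Finsupp.weight (homWeight w) α) + 2 * Finsupp.weight (homWeight w) α := by omega
        rw [this]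
        exact ho.add_even (even_two_mul _)
      rw [← mul_assoc, hsign]; simp

/-- Existence of zeros on the cylinder for perturbed polynomial systems with parity. -/
theorem exists_zero_on_cylinder {m : ℕ} {ι : Type*} [Fintype ι] {w : ι → ℕ} (hw : ∀ i, w i ≠ 0)
    {q : Fin m ⊕ ι → ℕ} (hq : ∀ k, Odd (q k))
    {P : Fin m ⊕ ι → MvPolynomial (Option (Fin m ⊕ ι)) ℝ}
    (hP : ∀ k, P k ∈ wdegLE (homWeight w) (homWeight w (some k) * q k)) :
    ∃ S : Set ℝ, S.Countable ∧ ∀ ε ∉ S, ∃ z : Option (Fin m ⊕ ι) → ℝ,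
      z none ^ 2 + ∑ i, z (some (Sum.inl i)) ^ 2 = 1 ∧
      ∀ k, (eval z (P k) + (-1) ^ homWeight w (some k) * eval (signFlip (homWeight w) z) (P k)) / 2
        + ε * z (some k) ^ q k = 0 := by
  choose f hf hfe using fun k => exists_dehomogenization w _ (hP k)
  have hw0 : ∀ k : Fin m ⊕ ι, homWeight w (some k) ≠ 0 := by
    rintro (i | i)
    · exact one_ne_zero
    · exact hw i
  obtain ⟨S, hS, h⟩ := exists_real_zero_perturb hw0 hq hf
  refine ⟨S, hS, fun ε hε => ?_⟩
  obtain ⟨x, hx⟩ := h ε hε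
  have hpos : 0 < 1 + ∑ i : Fin m, x (Sum.inl i) ^ 2 := by positivity
  set ρ := √(1 + ∑ i, x (Sum.inl i) ^ 2) with hρ
  have hρ0 : ρ ≠ 0 := (Real.sqrt_pos.mpr hpos).ne'
  have hρ2 : 1 + ∑ i : Fin m, x (Sum.inl i) ^ 2 = ρ ^ 2 := (Real.sq_sqrt hpos.le).symm
  refine ⟨cylPoint w x, ?_, fun k => ?_⟩
  · have h1 : cylPoint w x none = ρ⁻¹ := rfl
    have h2 : ∀ i, cylPoint w x (some (Sum.inl i)) = x (Sum.inl i) / ρ := by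
      intro i; simp [cylPoint, homWeight, hρ]
    simp only [h1, h2, div_pow, ← Finset.sum_div]
    have : ∑ i : Fin m, x (Sum.inl i) ^ 2 = ρ ^ 2 - 1 := by linarith
    rw [this]; field_simp; ring
  · have h1 : x k = cylPoint w x (some k) * ρ ^ homWeight w (some k) := by
      simp only [cylPoint, Option.elim, ← hρ]; field_simp
    have h2 := hx k
    rw [hfe, ← hρ] at h2
    have h4 : x k ^ q k = (cylPoint w x (some k) * ρ ^ homWeight w (some k)) ^ q k :=
      congrArg (· ^ q k) h1
    rw [h4] at h2
    have hsgn : ((-1 : ℝ) ^ (homWeight w (some k) * q k)) = (-1) ^ homWeight w (some k) := by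
      rw [mul_comm, pow_mul, (hq k).neg_one_pow]
    rw [hsgn, mul_pow, ← pow_mul] at h2
    have h3 : ρ ^ (homWeight w (some k) * q k) ≠ 0 := pow_ne_zero _ hρ0
    apply mul_left_cancel₀ h3
    rw [mul_zero, ← h2]; ring

/-- **Weierstrass approximation** in several variables. -/
theorem exists_mvPolynomial_near {κ : Type*} {s : Set (κ → ℝ)} (hs : IsCompact s)
    {f : (κ → ℝ) → ℝ} (hf : ContinuousOn f s) {ε : ℝ} (hε : 0 < ε) :
    ∃ p : MvPolynomial κ ℝ, ∀ z ∈ s, |eval z p - f z| < ε := by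
  have := isCompact_iff_compactSpace.mp hs
  let x : κ → C(s, ℝ) := fun v => ⟨fun z => z.1 v, (continuous_apply v).comp continuous_subtype_val⟩
  have hsep : (aeval x : MvPolynomial κ ℝ →ₐ[ℝ] C(s, ℝ)).range.SeparatesPoints := by
    intro a b hab
    obtain ⟨v, hv⟩ := Function.ne_iff.mp (Subtype.coe_ne_coe.mpr hab)
    exact ⟨x v, ⟨x v, ⟨X v, by simp⟩, rfl⟩, hv⟩
  obtain ⟨⟨g, p, hp⟩, hg⟩ :=
    ContinuousMap.exists_mem_subalgebra_near_continuous_of_separatesPoints _ hsep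
      (s.domRestrict f) hf.domRestrict ε hε
  refine ⟨p, fun z hz => ?_⟩
  have h1 : eval z p = g ⟨z, hz⟩ := by
    rw [← hp]
    have : ∀ q : MvPolynomial κ ℝ, eval z q = (aeval x q : C(s, ℝ)) ⟨z, hz⟩ := by
      intro q
      induction q using MvPolynomial.induction_on with
      | C a => simp
      | add p q hp hq => simp [hp, hq]
      | mul_X p v hp => simp [hp, x]
    exact this p
  have := hg ⟨z, hz⟩
  rw [h1]
  exact this

theorem exists_growth_bound {κ : Type*} (p : MvPolynomial κ ℝ) :
    ∃ (B : ℝ) (D : ℕ), 0 ≤ B ∧ ∀ (z : κ → ℝ) (t : ℝ), 1 ≤ t → (∀ v, |z v| ≤ t) →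
      |eval z p| ≤ B * t ^ D := by
  induction p using MvPolynomial.induction_on with
  | C a => exact ⟨|a|, 0, abs_nonneg a, fun z t _ _ => by simp⟩
  | add p q hp hq =>
    obtain ⟨B, D, hB, h⟩ := hp
    obtain ⟨B', D', hB', h'⟩ := hq
    refine ⟨B + B', D + D', add_nonneg hB hB', fun z t ht hz => ?_⟩
    have h1 : t ^ D ≤ t ^ (D + D') := pow_le_pow_right₀ ht (by omega)
    have h2 : t ^ D' ≤ t ^ (D + D') := pow_le_pow_right₀ ht (by omega)
    rw [map_add]
    calc _ ≤ |eval z p| + |eval z q| := abs_add_le _ _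
      _ ≤ B * t ^ D + B' * t ^ D' := add_le_add (h z t ht hz) (h' z t ht hz)
      _ ≤ B * t ^ (D + D') + B' * t ^ (D + D') := by gcongr
      _ = _ := by ring
  | mul_X p v hp =>
    obtain ⟨B, D, hB, h⟩ := hp
    refine ⟨B, D + 1, hB, fun z t ht hz => ?_⟩
    rw [eval_mul, eval_X, abs_mul, pow_succ, ← mul_assoc]
    exact mul_le_mul (h z t ht hz) (hz v) (abs_nonneg _) (by positivity)

theorem exists_uniform_growth_bound {κ κ' : Type*} [Fintype κ'] (p : κ' → MvPolynomial κ ℝ) :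
    ∃ (B : ℝ) (D : ℕ), ∀ k (z : κ → ℝ) (t : ℝ), 1 ≤ t → (∀ v, |z v| ≤ t) →
      |eval z (p k)| ≤ B * t ^ D := by
  choose B D hB h using fun k => exists_growth_bound (p k)
  refine ⟨∑ k, B k, ∑ k, D k, fun k z t ht hz => (h k z t ht hz).trans ?_⟩
  have h1 : B k ≤ ∑ k, B k := Finset.single_le_sum (fun i _ => hB i) (Finset.mem_univ k)
  have h2 : D k ≤ ∑ k, D k := Finset.single_le_sum (fun i _ => Nat.zero_le _) (Finset.mem_univ k)
  have h3 : t ^ D k ≤ t ^ ∑ k, D k := pow_le_pow_right₀ ht h2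
  have : 0 ≤ ∑ k, B k := Finset.sum_nonneg fun k _ => hB k
  gcongr

theorem exists_mem_wdegLE {κ : Type*} (w : κ → ℕ) (p : MvPolynomial κ ℝ) : ∃ d, p ∈ wdegLE w d := by
  induction p using MvPolynomial.monomial_add_induction_on with
  | C a => exact ⟨0, monomial_mem_wdegLE (by simp)⟩
  | monomial_add α a p _ _ hp =>
    obtain ⟨d, hd⟩ := hp
    exact ⟨max (Finsupp.weight w α) d, Submodule.add_mem _
      (monomial_mem_wdegLE (le_max_left _ _)) (wdegLE_mono w (le_max_right _ _) hd)⟩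

/-- The cylinder over the unit sphere `{z₀² + ∑ zᵢ² = 1}`. -/
def cylinder (m : ℕ) (ι : Type*) : Set (Option (Fin m ⊕ ι) → ℝ) :=
  {z | z none ^ 2 + ∑ i, z (some (Sum.inl i)) ^ 2 = 1}

theorem abs_signFlip {κ : Type*} (w : κ → ℕ) (z : κ → ℝ) (v : κ) : |signFlip w z v| = |z v| := by
  simp [signFlip, abs_mul, abs_pow]

theorem signFlip_mem_cylinder {m : ℕ} {ι : Type*} {w : Option (Fin m ⊕ ι) → ℕ}
    {z : Option (Fin m ⊕ ι) → ℝ} (hz : z ∈ cylinder m ι) : signFlip w z ∈ cylinder m ι := by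
  rw [cylinder, mem_ofPred_eq] at *
  simp only [← sq_abs (signFlip w z _), abs_signFlip]
  simpa only [sq_abs] using hz

theorem abs_none_le_one {m : ℕ} {ι : Type*} {z : Option (Fin m ⊕ ι) → ℝ}
    (hz : z ∈ cylinder m ι) : |z none| ≤ 1 := by
  rw [cylinder, mem_ofPred_eq] at hz
  rw [← sq_le_one_iff_abs_le_one]
  have : 0 ≤ ∑ i, z (some (Sum.inl i)) ^ 2 := Finset.sum_nonneg fun i _ => sq_nonneg _
  linarith

theorem abs_inl_le_one {m : ℕ} {ι : Type*} {z : Option (Fin m ⊕ ι) → ℝ}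
    (hz : z ∈ cylinder m ι) (i : Fin m) : |z (some (Sum.inl i))| ≤ 1 := by
  rw [cylinder, mem_ofPred_eq] at hz
  rw [← sq_le_one_iff_abs_le_one]
  have : z (some (Sum.inl i)) ^ 2 ≤ ∑ i, z (some (Sum.inl i)) ^ 2 :=
    Finset.single_le_sum (f := fun i => z (some (Sum.inl i)) ^ 2)
      (fun i _ => sq_nonneg _) (Finset.mem_univ i)
  nlinarith [sq_nonneg (z none)]

theorem isCompact_cylinder_inter {m : ℕ} {ι : Type*} (T : ℝ) :
    IsCompact (cylinder m ι ∩ {z | ∀ j, |z (some (Sum.inr j))| ≤ T}) := by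
  refine IsCompact.of_isClosed_subset
    (isCompact_univ_pi fun _ : Option (Fin m ⊕ ι) => isCompact_Icc (a := -max 1 T) (b := max 1 T))
    (IsClosed.inter ?_ ?_) ?_
  · exact isClosed_eq (by fun_prop) (by fun_prop)
  · simp only [ofPred_forall]
    exact isClosed_iInter fun j => isClosed_le (by fun_prop) (by fun_prop)
  · rintro z ⟨hz, hz'⟩ v -
    refine abs_le.mp ?_
    rcases v with _ | i | j
    · exact (abs_none_le_one hz).trans (le_max_left _ _)
    · exact (abs_inl_le_one hz i).trans (le_max_left _ _)
    · exact (hz' j).trans (le_max_right _ _)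

/-- A continuous map with parity on the cylinder, asymptotic to the identity, has a zero. -/
theorem exists_zero_of_parity {m : ℕ} {ι : Type*} [Fintype ι] {w : ι → ℕ} (hw : ∀ i, w i ≠ 0)
    {F : (Option (Fin m ⊕ ι) → ℝ) → Fin m ⊕ ι → ℝ} (hFc : ContinuousOn F (cylinder m ι))
    (hFe : ∀ z ∈ cylinder m ι, ∀ k,
      F (signFlip (homWeight w) z) k = (-1) ^ homWeight w (some k) * F z k)
    {c : ℝ} (hFb : ∀ z ∈ cylinder m ι, ∀ j, |F z (Sum.inr j) - z (some (Sum.inr j))| ≤ c) :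
    ∃ z ∈ cylinder m ι, F z = 0 := by
  by_contra! hne
  have hz0 : (fun v => v.elim 1 fun _ => 0) ∈ cylinder m ι := by simp [cylinder]
  set R := |c| + 2 with hR
  have hR2 : 2 ≤ R := by rw [hR]; linarith [abs_nonneg c]
  have hR0 : 0 < R := by linarith
  have hcR : c ≤ R - 2 := by rw [hR]; linarith [le_abs_self c]
  -- a lower bound on the compact part
  obtain ⟨δ, hδ0, hδ1, hδ⟩ : ∃ δ > 0, δ ≤ 1 ∧ ∀ z ∈ cylinder m ι,
      (∀ j, |z (some (Sum.inr j))| ≤ R) → δ ≤ ‖F z‖ := by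
    obtain ⟨z₁, hz₁, hmin⟩ := (isCompact_cylinder_inter R).exists_isMinOn
      (s := cylinder m ι ∩ {z | ∀ j, |z (some (Sum.inr j))| ≤ R})
      ⟨_, hz0, by simp [hR0.le]⟩ ((hFc.mono inter_subset_left).norm)
    refine ⟨min ‖F z₁‖ 1, lt_min (norm_pos_iff.mpr (hne _ hz₁.1)) one_pos, min_le_right _ _, ?_⟩
    intro z hz hzR
    exact (min_le_left _ _).trans (hmin ⟨hz, hzR⟩)
  -- polynomial approximation
  have happ : ∀ k, ∃ p : MvPolynomial (Option (Fin m ⊕ ι)) ℝ,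
      ∀ z ∈ cylinder m ι ∩ {z | ∀ j, |z (some (Sum.inr j))| ≤ 2 * R},
        |eval z p - F z k| < δ / 4 := fun k =>
    exists_mvPolynomial_near (isCompact_cylinder_inter (2 * R))
      ((continuousOn_pi.mp (hFc.mono inter_subset_left)) k) (by positivity)
  choose p hp using happ
  obtain ⟨B, D, hBD⟩ := exists_uniform_growth_bound p
  choose d hd using fun k => exists_mem_wdegLE (homWeight w) (p k)
  obtain ⟨a, ha⟩ : ∃ a : ℕ, B * R ^ D / (δ / 4) < 2 ^ a := pow_unbounded_of_one_lt _ one_lt_two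
  obtain ⟨q, hqo, hqa, hqd⟩ : ∃ q, Odd q ∧ D + a ≤ q ∧ ∀ k, d k ≤ q := by
    refine ⟨2 * (D + a + ∑ k, d k) + 1, ⟨_, rfl⟩, by omega, fun k => ?_⟩
    have : d k ≤ ∑ k, d k := Finset.single_le_sum (fun i _ => Nat.zero_le _) (Finset.mem_univ k)
    omega
  have hW0 : ∀ k : Fin m ⊕ ι, 1 ≤ homWeight w (some k) := by
    rintro (i | i)
    · exact le_rfl
    · exact Nat.one_le_iff_ne_zero.mpr (hw i)
  let g : Fin m ⊕ ι → ℝ := Sum.elim (fun _ => 1) fun _ => R ^ q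
  obtain ⟨S, hS, hzero⟩ := exists_zero_on_cylinder hw (q := fun _ => q) (fun _ => hqo)
    (P := fun k => g k • p k) (fun k => Submodule.smul_mem _ _
      (wdegLE_mono _ ((hqd k).trans (Nat.le_mul_of_pos_left q (hW0 k))) (hd k)))
  obtain ⟨ε, ⟨hε1, hε2⟩, hεS⟩ : ∃ ε ∈ Ioo (δ / 4) (δ / 2), ε ∉ S := by
    obtain ⟨ε, h1, h2⟩ := (hS.dense_compl ℝ).inter_open_nonempty _ isOpen_Ioo
      (nonempty_Ioo.mpr (by linarith : δ / 4 < δ / 2))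
    exact ⟨ε, h1, h2⟩
  have hε0 : 0 < ε := by linarith
  obtain ⟨z, hz, hzk⟩ := hzero ε hεS
  replace hz : z ∈ cylinder m ι := hz
  set P : Fin m ⊕ ι → ℝ := fun k =>
    (eval z (p k) + (-1) ^ homWeight w (some k) * eval (signFlip (homWeight w) z) (p k)) / 2 with hP
  have hzl : ∀ i, P (Sum.inl i) + ε * z (some (Sum.inl i)) ^ q = 0 := by
    intro i
    have := hzk (Sum.inl i)
    simpa [g] using this
  have hzr : ∀ j, P (Sum.inr j) + ε * (z (some (Sum.inr j)) / R) ^ q = 0 := by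
    intro j
    have := hzk (Sum.inr j)
    simp only [g, Sum.elim_inr, smul_eval] at this
    rw [div_pow]
    have hRq : R ^ q ≠ 0 := by positivity
    apply mul_left_cancel₀ hRq
    rw [mul_zero, ← this, hP]
    field_simp
  -- symmetrization preserves the approximation and the growth
  have hPF : (∀ j, |z (some (Sum.inr j))| ≤ 2 * R) → ∀ k, |P k - F z k| < δ / 4 := by
    intro hb k
    have h1 := hp k z ⟨hz, hb⟩
    have h2 := hp k (signFlip (homWeight w) z)
      ⟨signFlip_mem_cylinder hz, fun j => by rw [abs_signFlip]; exact hb j⟩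
    rw [hFe z hz] at h2
    rw [abs_lt] at *
    simp only [hP]
    rcases neg_one_pow_eq_or ℝ (homWeight w (some k)) with h | h
    · rw [h, one_mul] at h2 ⊢; constructor <;> linarith
    · rw [h, neg_one_mul] at h2 ⊢; constructor <;> linarith
  have hPB : ∀ t, 1 ≤ t → (∀ j, |z (some (Sum.inr j))| ≤ t) → ∀ k, |P k| ≤ B * t ^ D := by
    intro t ht hb k
    have hv : ∀ v, |z v| ≤ t := by
      rintro (_ | i | j)
      · exact (abs_none_le_one hz).trans ht
      · exact (abs_inl_le_one hz i).trans ht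
      · exact hb j
    have h1 := hBD k z t ht hv
    have h2 := hBD k (signFlip (homWeight w) z) t ht fun v => by rw [abs_signFlip]; exact hv v
    rw [abs_le] at *
    simp only [hP]
    rcases neg_one_pow_eq_or ℝ (homWeight w (some k)) with h | h <;> rw [h] <;>
      constructor <;> linarith
  by_cases hbR : ∀ j, |z (some (Sum.inr j))| ≤ R
  · have hF := hPF fun j => (hbR j).trans (by linarith)
    have hlt : ‖F z‖ < δ := by
      rw [pi_norm_lt_iff hδ0]
      intro k
      rw [Real.norm_eq_abs]
      have hsmall : |P k| ≤ ε := by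
        obtain ⟨x, hx1, hx⟩ : ∃ x : ℝ, |x| ≤ 1 ∧ P k + ε * x ^ q = 0 := by
          rcases k with i | j
          · exact ⟨_, abs_inl_le_one hz i, hzl i⟩
          · refine ⟨_, ?_, hzr j⟩
            rw [abs_div, abs_of_pos hR0, div_le_one hR0]
            exact hbR j
        have : P k = -(ε * x ^ q) := by linarith
        rw [this, abs_neg, abs_mul, abs_of_pos hε0, abs_pow]
        exact mul_le_of_le_one_right hε0.le (pow_le_one₀ (abs_nonneg x) hx1)
      have := hF k
      rw [abs_lt] at *
      rw [abs_le] at hsmall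
      constructor <;> linarith
    exact absurd (hδ z hz hbR) (not_le.mpr hlt)
  · push Not at hbR
    obtain ⟨j₀, hj₀⟩ := hbR
    have : Nonempty ι := ⟨j₀⟩
    obtain ⟨j, hj⟩ := Finite.exists_max fun j => |z (some (Sum.inr j))|
    have hjR : R < |z (some (Sum.inr j))| := hj₀.trans_le (hj j₀)
    set y := z (some (Sum.inr j)) with hy
    have hzj := hzr j
    by_cases hyR : |y| ≤ 2 * R
    · have h1 := hPF (fun j' => (hj j').trans hyR) (Sum.inr j)
      have h2 := hFb z hz j
      rw [← hy] at h2 hzj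
      rw [abs_le] at h2
      rw [abs_lt] at h1
      rcases lt_abs.mp hjR with h | h
      · have : 0 < (y / R) ^ q := by
          have : 0 < y := by linarith
          positivity
        nlinarith
      · have : (y / R) ^ q < 0 := hqo.pow_neg (div_neg_of_neg_of_pos (by linarith) hR0)
        nlinarith
    · push Not at hyR
      have h1 := hPB |y| (by linarith) hj (Sum.inr j)
      have h2 : P (Sum.inr j) = -(ε * (y / R) ^ q) := by linarith
      rw [h2, abs_neg, abs_mul, abs_of_pos hε0, abs_pow, abs_div, abs_of_pos hR0] at h1
      have h3 : 2 ≤ |y| / R := by rw [le_div_iff₀ hR0]; exact hyR.le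
      have h4 : 2 ^ a * (|y| / R) ^ D ≤ (|y| / R) ^ q := calc
        _ ≤ (|y| / R) ^ a * (|y| / R) ^ D := by gcongr
        _ = (|y| / R) ^ (D + a) := by ring
        _ ≤ _ := pow_le_pow_right₀ (by linarith) hqa
      have hy0 : 0 < |y| := by linarith
      have h5 : B * R ^ D < δ / 4 * 2 ^ a := by
        rw [div_lt_iff₀ (by positivity)] at ha; linarith
      have h6 : B * |y| ^ D = B * R ^ D * (|y| / R) ^ D := by
        rw [div_pow]; field_simp
      have h7 : 0 < (|y| / R) ^ D := by positivity
      have h8 : δ / 4 * (2 ^ a * (|y| / R) ^ D) ≤ ε * (|y| / R) ^ q := by gcongr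
      nlinarith

end Polynomials

/-- The map of spheres induced by a linear isometry. -/
noncomputable def sphMap {n : ℕ}
    (T : EuclideanSpace ℝ (Fin (n + 1)) ≃ₗᵢ[ℝ] EuclideanSpace ℝ (Fin (n + 1))) :
    Sph n → Sph n := fun x =>
  ⟨T x, by
    have hx : ‖(x : EuclideanSpace ℝ (Fin (n + 1)))‖ = 1 := mem_sphere_zero_iff_norm.mp x.2
    simp [T.norm_map, hx]⟩

/-- The point of the sphere corresponding to a point of the cylinder. -/
noncomputable def cylinderToSph {m : ℕ} {ι : Type*} (z : cylinder m ι) : Sph m :=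
  ⟨WithLp.toLp 2 (Fin.cons (z.1 none) fun i => z.1 (some (Sum.inl i))), by
    rw [mem_sphere_zero_iff_norm, EuclideanSpace.norm_eq, Real.sqrt_eq_one, Fin.sum_univ_succ]
    have hz : z.1 none ^ 2 + ∑ i, z.1 (some (Sum.inl i)) ^ 2 = 1 := z.2
    simpa [sq_abs] using hz⟩

theorem continuous_cylinderToSph {m : ℕ} {ι : Type*} :
    Continuous (cylinderToSph : cylinder m ι → Sph m) := by
  refine Continuous.subtype_mk ((PiLp.continuous_toLp 2 _).comp (continuous_pi fun i => ?_)) _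
  refine Fin.cases ?_ (fun i => ?_) i
  · simp only [Fin.cons_zero]; exact (continuous_apply _).comp continuous_subtype_val
  · simp only [Fin.cons_succ]; exact (continuous_apply _).comp continuous_subtype_val

/-- The linear part of a point of the cylinder. -/
noncomputable def cylinderToLin {m : ℕ} {J : Type*} {N : J → ℕ}
    (z : cylinder m (Σ j, Fin (N j + 1))) : ∀ j, EuclideanSpace ℝ (Fin (N j + 1)) :=
  fun j => WithLp.toLp 2 fun k => z.1 (some (Sum.inr ⟨j, k⟩))

theorem continuous_cylinderToLin {m : ℕ} {J : Type*} {N : J → ℕ} :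
    Continuous (cylinderToLin : cylinder m (Σ j, Fin (N j + 1)) → _) :=
  continuous_pi fun _ => (PiLp.continuous_toLp 2 _).comp
    (continuous_pi fun _ => (continuous_apply _).comp continuous_subtype_val)

/-- An equivariant self-map of `S^m × V` at bounded distance from the projection has a zero. -/
theorem exists_zero_of_equivariant {m : ℕ} {J : Type*} [Fintype J] {N : J → ℕ}
    {w : ∀ j, Fin (N j + 1) → ℕ} (hw : ∀ j k, w j k ≠ 0)
    {T : ∀ j, EuclideanSpace ℝ (Fin (N j + 1)) ≃ₗᵢ[ℝ] EuclideanSpace ℝ (Fin (N j + 1))}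
    (hT : ∀ j y k, T j y k = (-1) ^ w j k * y k)
    {F : Sph m → (∀ j, EuclideanSpace ℝ (Fin (N j + 1))) → Fin m → ℝ}
    {G : Sph m → (∀ j, EuclideanSpace ℝ (Fin (N j + 1))) →
      ∀ j, EuclideanSpace ℝ (Fin (N j + 1))}
    (hF : Continuous (Function.uncurry F)) (hG : Continuous (Function.uncurry G))
    (hFe : ∀ u y a, F (negSph m u) (fun j => T j (y j)) a = -F u y a)
    (hGe : ∀ u y j, G (negSph m u) (fun j => T j (y j)) j = T j (G u y j))
    {c : ℝ} (hGb : ∀ u y j, ‖G u y j - y j‖ ≤ c) :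
    ∃ u y, (∀ a, F u y a = 0) ∧ ∀ j, G u y j = 0 := by
  classical
  let ι := Σ j, Fin (N j + 1)
  let W : ι → ℕ := fun k => w k.1 k.2
  let Φ₀ : cylinder m ι → Fin m ⊕ ι → ℝ := fun z => Sum.elim (F (cylinderToSph z) (cylinderToLin z))
    fun k => G (cylinderToSph z) (cylinderToLin z) k.1 k.2
  let Φ : (Option (Fin m ⊕ ι) → ℝ) → Fin m ⊕ ι → ℝ := fun z =>
    if hz : z ∈ cylinder m ι then Φ₀ ⟨z, hz⟩ else 0
  have hΦ : ∀ z (hz : z ∈ cylinder m ι), Φ z = Φ₀ ⟨z, hz⟩ := fun z hz => dif_pos hz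
  have hΦ₀ : Continuous Φ₀ := by
    have hc : Continuous fun z : cylinder m ι => (cylinderToSph z, cylinderToLin z) :=
      continuous_cylinderToSph.prodMk continuous_cylinderToLin
    refine continuous_pi ?_
    rintro (i | ⟨j, k⟩)
    · exact (continuous_apply i).comp (hF.comp hc)
    · exact (EuclideanSpace.proj (𝕜 := ℝ) k).continuous.comp
        ((continuous_apply j).comp (hG.comp hc))
  have hflip : ∀ z (hz : z ∈ cylinder m ι),
      cylinderToSph ⟨signFlip (homWeight W) z, signFlip_mem_cylinder hz⟩ =
        negSph m (cylinderToSph ⟨z, hz⟩) ∧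
      cylinderToLin ⟨signFlip (homWeight W) z, signFlip_mem_cylinder hz⟩ =
        fun j => T j (cylinderToLin ⟨z, hz⟩ j) := by
    intro z hz
    constructor
    · refine Subtype.ext (PiLp.ext fun i => ?_)
      refine Fin.cases ?_ (fun i => ?_) i <;> simp [cylinderToSph, negSph, signFlip, homWeight]
    · funext j
      refine PiLp.ext fun k => ?_
      rw [hT]
      simp [cylinderToLin, signFlip, homWeight, W]
  obtain ⟨z, hz, h0⟩ := exists_zero_of_parity (w := W) (fun k => hw k.1 k.2) (F := Φ) (c := c)
    (by
      rw [continuousOn_iff_continuous_domRestrict]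
      convert hΦ₀ using 1
      funext z
      exact hΦ z z.2)
    (by
      intro z hz k
      rw [hΦ _ (signFlip_mem_cylinder hz), hΦ _ hz]
      simp only [Φ₀]
      rw [(hflip z hz).1, (hflip z hz).2]
      rcases k with i | ⟨j, k⟩
      · simp [hFe, homWeight]
      · simp [hGe, hT, homWeight, W])
    (by
      rintro z hz ⟨j, k⟩
      rw [hΦ _ hz]
      refine le_trans ?_ (hGb (cylinderToSph ⟨z, hz⟩) (cylinderToLin ⟨z, hz⟩) j)
      exact PiLp.norm_apply_le (G (cylinderToSph ⟨z, hz⟩) (cylinderToLin ⟨z, hz⟩) j -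
        cylinderToLin ⟨z, hz⟩ j) k)
  rw [hΦ _ hz] at h0
  refine ⟨_, _, fun a => congrFun h0 (Sum.inl a), fun j => PiLp.ext fun k => ?_⟩
  exact congrFun h0 (Sum.inr ⟨j, k⟩)

/-- On a normal space the homotopies of an equivariant categorical cover can be extended to global
ones, keeping the end condition on a closed refinement. -/
theorem HasEqCatCover.exists_global_homotopies {X : Type*} [TopologicalSpace X] [NormalSpace X]
    {τ : X → X} (hτc : Continuous τ) (hττ : ∀ x, τ (τ x) = x) {k : ℕ} (hk : HasEqCatCover τ k) :
    ∃ (b : Fin k → X) (h : Fin k → X × unitInterval → X), (∀ i, Continuous (h i)) ∧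
      (∀ i x, h i (x, 0) = x) ∧ (∀ i x t, h i (τ x, t) = τ (h i (x, t))) ∧
      ∀ x, ∃ i, h i (x, 1) = b i ∨ h i (x, 1) = τ (b i) := by
  classical
  obtain ⟨U, hUo, hUc, hUτ, hH⟩ := hk
  choose b H hH0 hH1 hHτ using hH
  obtain ⟨V, hVc, hV, hVU⟩ := exists_iUnion_eq_closed_subset hUo (fun x => Set.toFinite _) hUc
  have hτU : ∀ i x, x ∈ U i → τ x ∈ U i := fun i x hx => by
    rw [← hUτ i]; exact mem_image_of_mem τ hx
  have hτU' : ∀ i x, τ x ∈ U i ↔ x ∈ U i := fun i x =>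
    ⟨fun hx => by have := hτU i _ hx; rwa [hττ] at this, hτU i x⟩
  choose f hf0 hf1 hf using fun i => exists_continuous_zero_one_of_isClosed
    (hUo i).isClosed_compl (hV i) (disjoint_left.mpr fun x hx hx' => hx (hVU i hx'))
  let g : Fin k → X → ℝ := fun i x => max (f i x) (f i (τ x))
  have hgc : ∀ i, Continuous (g i) := fun i => by fun_prop
  have hg1 : ∀ i x, g i x ≤ 1 := fun i x => max_le (hf i x).2 (hf i _).2
  have hgτ : ∀ i x, g i (τ x) = g i x := fun i x => by simp only [g, hττ]; exact max_comm _ _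
  have hgV : ∀ i, ∀ x ∈ V i, g i x = 1 := fun i x hx =>
    le_antisymm (hg1 i x) ((hf1 i hx).symm.le.trans (le_max_left _ _))
  have hgU : ∀ i, ∀ x ∉ U i, g i x = 0 := fun i x hx => by
    have h1 : f i x = 0 := hf0 i hx
    have h2 : f i (τ x) = 0 := hf0 i (fun h => hx ((hτU' i x).mp h))
    simp [g, h1, h2]
  let φ : Fin k → X → unitInterval := fun i x => ⟨max 0 (2 * g i x - 1), le_max_left _ _,
    max_le zero_le_one (by linarith [hg1 i x])⟩
  have hφc : ∀ i, Continuous (φ i) := fun i =>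
    (continuous_const.max ((continuous_const.mul (hgc i)).sub continuous_const)).subtype_mk _
  have hφ0 : ∀ i x, g i x ≤ 1 / 2 → φ i x = 0 := fun i x hx =>
    Subtype.ext (max_eq_left (by linarith))
  have hφ1 : ∀ i x, x ∈ V i → φ i x = 1 := fun i x hx => Subtype.ext (by
    change max 0 (2 * g i x - 1) = 1
    rw [hgV i x hx]; norm_num)
  let h : Fin k → X × unitInterval → X := fun i z =>
    if hz : z.1 ∈ U i then H i (⟨z.1, hz⟩, z.2 * φ i z.1) else z.1
  have hU : ∀ i x (hx : x ∈ U i) t, h i (x, t) = H i (⟨x, hx⟩, t * φ i x) :=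
    fun i x hx t => dif_pos hx
  have hU' : ∀ i x, x ∉ U i → ∀ t, h i (x, t) = x := fun i x hx t => dif_neg hx
  refine ⟨b, h, fun i => ?_, fun i x => ?_, fun i x t => ?_, fun x => ?_⟩
  · rw [continuous_iff_continuousAt]
    rintro ⟨x, t⟩
    by_cases hx : x ∈ U i
    · have ho : IsOpen (Prod.fst ⁻¹' U i : Set (X × unitInterval)) :=
        (hUo i).preimage continuous_fst
      refine ContinuousOn.continuousAt ?_ (ho.mem_nhds hx)
      rw [continuousOn_iff_continuous_domRestrict]
      have hc : Continuous fun z : (Prod.fst ⁻¹' U i : Set (X × unitInterval)) =>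
          H i (⟨z.1.1, z.2⟩, z.1.2 * φ i z.1.1) := by
        refine (H i).continuous.comp (Continuous.prodMk ?_ ?_)
        · exact (continuous_fst.comp continuous_subtype_val).subtype_mk _
        · exact (continuous_snd.comp continuous_subtype_val).mul
            ((hφc i).comp (continuous_fst.comp continuous_subtype_val))
      convert hc using 1
      funext z
      exact hU i z.1.1 z.2 z.1.2
    · have ho : IsOpen {z : X × unitInterval | g i z.1 < 1 / 2} :=
        isOpen_lt ((hgc i).comp continuous_fst) continuous_const
      have hmem : (x, t) ∈ {z : X × unitInterval | g i z.1 < 1 / 2} := by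
        rw [mem_ofPred_eq, hgU i x hx]; norm_num
      refine continuous_fst.continuousAt.congr ?_
      filter_upwards [ho.mem_nhds hmem] with z hz
      by_cases hzU : z.1 ∈ U i
      · rw [hU i z.1 hzU, hφ0 i z.1 (le_of_lt hz), mul_zero, hH0]
      · rw [hU' i z.1 hzU]
  · by_cases hx : x ∈ U i
    · rw [hU i x hx, zero_mul, hH0]
    · exact hU' i x hx 0
  · by_cases hx : x ∈ U i
    · have hφτ : φ i (τ x) = φ i x := Subtype.ext (by simp only [φ, hgτ])
      rw [hU i x hx, hU i _ (hτU i x hx), hφτ, hHτ i ⟨x, hx⟩]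
    · rw [hU' i x hx, hU' i _ (fun h => hx ((hτU' i x).mp h))]
  · obtain ⟨i, hi⟩ := mem_iUnion.mp (hVc.symm ▸ mem_univ x : x ∈ ⋃ i, V i)
    refine ⟨i, ?_⟩
    have := hH1 i ⟨x, hVU i hi⟩
    rw [hU i x (hVU i hi), hφ1 i x hi, mul_one]
    simpa using this

/-- The diagonal involution `(u, y) ↦ (-u, T y)` of a product of spheres. -/
noncomputable def diagInv {m : ℕ} {J : Type*} {N : J → ℕ}
    (T : ∀ j, EuclideanSpace ℝ (Fin (N j + 1)) ≃ₗᵢ[ℝ] EuclideanSpace ℝ (Fin (N j + 1))) :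
    Sph m × (∀ j, Sph (N j)) → Sph m × (∀ j, Sph (N j)) :=
  fun x => (negSph m x.1, fun j => sphMap (T j) (x.2 j))

theorem continuous_negSph (n : ℕ) : Continuous (negSph n) :=
  Continuous.subtype_mk continuous_subtype_val.neg _

theorem continuous_sphMap {n : ℕ}
    (T : EuclideanSpace ℝ (Fin (n + 1)) ≃ₗᵢ[ℝ] EuclideanSpace ℝ (Fin (n + 1))) :
    Continuous (sphMap T) :=
  Continuous.subtype_mk (T.continuous.comp continuous_subtype_val) _

theorem continuous_diagInv {m : ℕ} {J : Type*} {N : J → ℕ}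
    (T : ∀ j, EuclideanSpace ℝ (Fin (N j + 1)) ≃ₗᵢ[ℝ] EuclideanSpace ℝ (Fin (N j + 1))) :
    Continuous (diagInv (m := m) T) :=
  ((continuous_negSph m).comp continuous_fst).prodMk (continuous_pi fun j =>
    (continuous_sphMap (T j)).comp ((continuous_apply j).comp continuous_snd))

theorem diagInv_diagInv {m : ℕ} {J : Type*} {N : J → ℕ}
    {T : ∀ j, EuclideanSpace ℝ (Fin (N j + 1)) ≃ₗᵢ[ℝ] EuclideanSpace ℝ (Fin (N j + 1))}
    (hT : ∀ j y, T j (T j y) = y) (x : Sph m × (∀ j, Sph (N j))) :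
    diagInv T (diagInv T x) = x := by
  refine Prod.ext (Subtype.ext (neg_neg _)) (funext fun j => Subtype.ext (hT j _))

theorem norm_coe_sph {n : ℕ} (x : Sph n) : ‖(x : EuclideanSpace ℝ (Fin (n + 1)))‖ = 1 :=
  mem_sphere_zero_iff_norm.mp x.2

/-- Radial projection to the unit sphere. -/
noncomputable def radial {n : ℕ} (y : EuclideanSpace ℝ (Fin (n + 1))) : Sph n := by
  classical
  exact if hy : y = 0 then ⟨EuclideanSpace.single 0 1, by simp⟩
    else ⟨‖y‖⁻¹ • y, by simp [norm_smul, hy]⟩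

theorem coe_radial {n : ℕ} {y : EuclideanSpace ℝ (Fin (n + 1))} (hy : y ≠ 0) :
    (radial y : EuclideanSpace ℝ (Fin (n + 1))) = ‖y‖⁻¹ • y := by
  rw [radial, dif_neg hy]

theorem norm_smul_radial {n : ℕ} (y : EuclideanSpace ℝ (Fin (n + 1))) :
    ‖y‖ • (radial y : EuclideanSpace ℝ (Fin (n + 1))) = y := by
  by_cases hy : y = 0
  · simp [hy]
  · rw [coe_radial hy, smul_inv_smul₀ (norm_ne_zero_iff.mpr hy)]

theorem radial_map {n : ℕ}
    (T : EuclideanSpace ℝ (Fin (n + 1)) ≃ₗᵢ[ℝ] EuclideanSpace ℝ (Fin (n + 1)))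
    {y : EuclideanSpace ℝ (Fin (n + 1))} (hy : y ≠ 0) : radial (T y) = sphMap T (radial y) := by
  refine Subtype.ext ?_
  change _ = T (radial y)
  rw [coe_radial hy, coe_radial (by simpa using hy), T.norm_map, map_smul]

theorem continuousAt_radial {n : ℕ} {y : EuclideanSpace ℝ (Fin (n + 1))} (hy : y ≠ 0) :
    ContinuousAt radial y := by
  rw [Topology.IsInducing.subtypeVal.continuousAt_iff]
  have : ContinuousAt (fun y : EuclideanSpace ℝ (Fin (n + 1)) => ‖y‖⁻¹ • y) y :=
    (continuousAt_id.norm.inv₀ (norm_ne_zero_iff.mpr hy)).smul continuousAt_id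
  refine this.congr ?_
  filter_upwards [isOpen_ne.mem_nhds hy] with z hz
  exact (coe_radial hz).symm

/-- A cut-off function on a product of Euclidean spaces, concentrated near the product of the unit
spheres. -/
noncomputable def sphereBump {J : Type*} [Fintype J] {N : J → ℕ}
    (y : ∀ j, EuclideanSpace ℝ (Fin (N j + 1))) : unitInterval :=
  ⟨∏ j, max 0 (1 - 2 * |‖y j‖ - 1|), Finset.prod_nonneg fun j _ => le_max_left _ _,
    Finset.prod_le_one (fun j _ => le_max_left _ _) fun j _ => max_le zero_le_one
      (by linarith [abs_nonneg (‖y j‖ - 1)])⟩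

theorem continuous_sphereBump {J : Type*} [Fintype J] {N : J → ℕ} :
    Continuous (sphereBump : (∀ j, EuclideanSpace ℝ (Fin (N j + 1))) → unitInterval) := by
  refine Continuous.subtype_mk ?_ _
  fun_prop

theorem sphereBump_eq_zero {J : Type*} [Fintype J] {N : J → ℕ}
    {y : ∀ j, EuclideanSpace ℝ (Fin (N j + 1))} {j : J} (h : 1 / 2 ≤ |‖y j‖ - 1|) :
    sphereBump y = 0 :=
  Subtype.ext (Finset.prod_eq_zero (Finset.mem_univ j) (max_eq_left (by linarith)))

theorem sphereBump_eq_one {J : Type*} [Fintype J] {N : J → ℕ}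
    {y : ∀ j, EuclideanSpace ℝ (Fin (N j + 1))} (h : ∀ j, ‖y j‖ = 1) : sphereBump y = 1 :=
  Subtype.ext (Finset.prod_eq_one fun j _ => by simp [h])

theorem sphereBump_map {J : Type*} [Fintype J] {N : J → ℕ}
    (T : ∀ j, EuclideanSpace ℝ (Fin (N j + 1)) ≃ₗᵢ[ℝ] EuclideanSpace ℝ (Fin (N j + 1)))
    (y : ∀ j, EuclideanSpace ℝ (Fin (N j + 1))) :
    sphereBump (fun j => T j (y j)) = sphereBump y := by
  simp [sphereBump]

/-- The lower bound for the size of an equivariant categorical cover. -/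
theorem HasEqCatCover.le_of_sections {m : ℕ} {J : Type*} [Fintype J] {N : J → ℕ}
    {w : ∀ j, Fin (N j + 1) → ℕ} (hw : ∀ j k, w j k ≠ 0)
    {T : ∀ j, EuclideanSpace ℝ (Fin (N j + 1)) ≃ₗᵢ[ℝ] EuclideanSpace ℝ (Fin (N j + 1))}
    (hT : ∀ j y k, T j y k = (-1) ^ w j k * y k)
    {s : ∀ j, Sph m → Sph (N j)} (hs : ∀ j, Continuous (s j))
    (hse : ∀ j u, s j (negSph m u) = sphMap (T j) (s j u))
    {k : ℕ} (hk : HasEqCatCover (diagInv (m := m) T) k) : m + Fintype.card J + 1 ≤ k := by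
  classical
  have hTT : ∀ j y, T j (T j y) = y := fun j y => PiLp.ext fun i => by
    rw [hT, hT, ← mul_assoc, ← pow_add, Even.neg_one_pow ⟨_, rfl⟩, one_mul]
  by_contra! hlt
  obtain ⟨b, h, hc, h0, he, h1⟩ :=
    hk.exists_global_homotopies (continuous_diagInv T) (diagInv_diagInv hTT)
  -- distribute the blocks among the members of the cover
  have hne : Nonempty (Fin k) :=
    ⟨(h1 (⟨EuclideanSpace.single 0 1, by simp⟩, fun j => ⟨EuclideanSpace.single 0 1, by simp⟩)).choose⟩
  obtain ⟨emb⟩ : Nonempty (Fin k ↪ Fin m ⊕ J) :=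
    Function.Embedding.nonempty_of_card_le (by simp; omega)
  obtain ⟨e, hesurj⟩ : ∃ e : Fin m ⊕ J → Fin k, Function.Surjective e :=
    ⟨_, Function.invFun_surjective emb.injective⟩
  -- choose the signs of the sections
  obtain ⟨σ, hσn, hσ, hσc, hσe⟩ : ∃ σ : ∀ j, Sph m → EuclideanSpace ℝ (Fin (N j + 1)),
      (∀ j u, ‖σ j u‖ = 1) ∧
      (∀ j, ((b (e (Sum.inr j))).2 j : EuclideanSpace ℝ (Fin (N j + 1))) ≠
        σ j (b (e (Sum.inr j))).1) ∧
      (∀ j, Continuous (σ j)) ∧ ∀ j u, σ j (negSph m u) = T j (σ j u) := by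
    have : ∀ j, ∃ σ : Sph m → EuclideanSpace ℝ (Fin (N j + 1)),
      (∀ u, ‖σ u‖ = 1) ∧ ((b (e (Sum.inr j))).2 j : EuclideanSpace ℝ (Fin (N j + 1))) ≠
        σ (b (e (Sum.inr j))).1 ∧ Continuous σ ∧ ∀ u, σ (negSph m u) = T j (σ u) := by
      intro j
      have hsj : ∀ u, (s j (negSph m u) : EuclideanSpace ℝ (Fin (N j + 1))) = T j (s j u) :=
        fun u => congrArg Subtype.val (hse j u)
      by_cases hj : ((b (e (Sum.inr j))).2 j : EuclideanSpace ℝ (Fin (N j + 1))) =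
        s j (b (e (Sum.inr j))).1
      · refine ⟨fun u => -s j u, fun u => by rw [norm_neg, norm_coe_sph], ?_,
          (continuous_subtype_val.comp (hs j)).neg, fun u => ?_⟩
        · rw [hj]
          intro h
          have h2 := norm_coe_sph (s j (b (e (Sum.inr j))).1)
          have h3 := eq_neg_iff_add_eq_zero.mp h
          rw [← two_smul ℝ, smul_eq_zero_iff_right two_ne_zero] at h3
          rw [h3, norm_zero] at h2
          exact zero_ne_one h2
        · simp only [hsj, map_neg]
      · exact ⟨fun u => s j u, fun u => norm_coe_sph _, hj,
          continuous_subtype_val.comp (hs j), hsj⟩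
    choose σ h1 h2 h3 h4 using this
    exact ⟨σ, h1, h2, h3, h4⟩
  let Q : Fin m ⊕ J → Sph m → (∀ j, EuclideanSpace ℝ (Fin (N j + 1))) → Sph m × ∀ j, Sph (N j) :=
    fun a u y => h (e a) ((u, fun j => radial (y j)), sphereBump y)
  have hQ0 : ∀ a u y, sphereBump y = 0 → Q a u y = (u, fun j => radial (y j)) := by
    intro a u y hy; simp only [Q, hy, h0]
  have hQe : ∀ a u y, (∀ j, y j ≠ 0) →
      Q a (negSph m u) (fun j => T j (y j)) = diagInv T (Q a u y) := by
    intro a u y hy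
    simp only [Q, sphereBump_map, ← he]
    congr 2
    exact Prod.ext rfl (funext fun j => radial_map (T j) (hy j))
  have hQc : ∀ a u y, (∀ j, y j ≠ 0) → ContinuousAt (Function.uncurry (Q a)) (u, y) := by
    intro a u y hy
    have h2 : ContinuousAt (fun z : Sph m × (∀ j, EuclideanSpace ℝ (Fin (N j + 1))) =>
        (((z.1, fun j => radial (z.2 j)), sphereBump z.2) :
          (Sph m × ∀ j, Sph (N j)) × unitInterval)) (u, y) := by
      refine ContinuousAt.prodMk (ContinuousAt.prodMk continuousAt_fst ?_)
        (continuous_sphereBump.comp continuous_snd).continuousAt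
      refine tendsto_pi_nhds.mpr fun j => ?_
      exact ContinuousAt.comp (x := (u, y)) (g := radial) (f := fun z : Sph m × (∀ j, _) => z.2 j)
        (continuousAt_radial (hy j))
        ((continuous_apply j).comp continuous_snd).continuousAt
    exact (hc (e a)).continuousAt.comp h2
  have hbz : ∀ {y : ∀ j, EuclideanSpace ℝ (Fin (N j + 1))}, (∃ j, ‖y j‖ < 1 / 2) →
      sphereBump y = 0 := by
    rintro y ⟨j, hj⟩
    refine sphereBump_eq_zero (j := j) ?_
    rw [abs_of_neg (by linarith)]; linarith
  have hsmall : ∀ {y : ∀ j, EuclideanSpace ℝ (Fin (N j + 1))}, (¬ ∀ j, y j ≠ 0) →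
      ∃ j, ‖y j‖ < 1 / 2 := by
    intro y hy
    push Not at hy
    obtain ⟨j, hj⟩ := hy
    exact ⟨j, by simp [hj]⟩
  have hopen : IsOpen {z : Sph m × (∀ j, EuclideanSpace ℝ (Fin (N j + 1))) |
      ∃ j, ‖z.2 j‖ < 1 / 2} := by
    simp only [ofPred_exists]
    exact isOpen_iUnion fun j => isOpen_lt (by fun_prop) continuous_const
  let F : Sph m → (∀ j, EuclideanSpace ℝ (Fin (N j + 1))) → Fin m → ℝ := fun u y a =>
    inner ℝ ((b (e (Sum.inl a))).1 : EuclideanSpace ℝ (Fin (m + 1))) (Q (Sum.inl a) u y).1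
  let G : Sph m → (∀ j, EuclideanSpace ℝ (Fin (N j + 1))) →
      ∀ j, EuclideanSpace ℝ (Fin (N j + 1)) := fun u y j =>
    ‖y j‖ • ((Q (Sum.inr j) u y).2 j : EuclideanSpace ℝ (Fin (N j + 1))) -
      σ j (Q (Sum.inr j) u y).1
  have hF0 : ∀ u y a, sphereBump y = 0 →
      F u y a = inner ℝ ((b (e (Sum.inl a))).1 : EuclideanSpace ℝ (Fin (m + 1))) u := by
    intro u y a hy; simp only [F, hQ0 _ _ _ hy]
  have hG0 : ∀ u y j, sphereBump y = 0 → G u y j = y j - σ j u := by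
    intro u y j hy; simp only [G, hQ0 _ _ _ hy, norm_smul_radial]
  have hFc : Continuous (Function.uncurry F) := by
    rw [continuous_iff_continuousAt]
    rintro ⟨u, y⟩
    refine tendsto_pi_nhds.mpr fun a => ?_
    by_cases hy : ∀ j, y j ≠ 0
    · exact ContinuousAt.inner (𝕜 := ℝ) continuousAt_const
        (continuous_subtype_val.continuousAt.comp (hQc (Sum.inl a) u y hy).fst)
    · have hstd : ContinuousAt (fun z : Sph m × (∀ j, EuclideanSpace ℝ (Fin (N j + 1))) =>
          inner ℝ ((b (e (Sum.inl a))).1 : EuclideanSpace ℝ (Fin (m + 1))) z.1) (u, y) := by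
        fun_prop
      refine hstd.congr ?_
      filter_upwards [hopen.mem_nhds (hsmall hy)] with z hz
      exact (hF0 z.1 z.2 a (hbz hz)).symm
  have hGc : Continuous (Function.uncurry G) := by
    rw [continuous_iff_continuousAt]
    rintro ⟨u, y⟩
    refine tendsto_pi_nhds.mpr fun j => ?_
    by_cases hy : ∀ j, y j ≠ 0
    · have hq := hQc (Sum.inr j) u y hy
      have hn : ContinuousAt (fun z : Sph m × (∀ j, EuclideanSpace ℝ (Fin (N j + 1))) =>
        ‖z.2 j‖) (u, y) := by fun_prop
      exact (hn.smul (continuous_subtype_val.continuousAt.comp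
        ((continuous_apply j).continuousAt.comp hq.snd))).sub
        ((hσc j).continuousAt.comp hq.fst)
    · have hstd : ContinuousAt (fun z : Sph m × (∀ j, EuclideanSpace ℝ (Fin (N j + 1))) =>
          z.2 j - σ j z.1) (u, y) :=
        (((continuous_apply j).comp continuous_snd).sub
          ((hσc j).comp continuous_fst)).continuousAt
      refine hstd.congr ?_
      filter_upwards [hopen.mem_nhds (hsmall hy)] with z hz
      exact (hG0 z.1 z.2 j (hbz hz)).symm
  have hTne : ∀ {y : ∀ j, EuclideanSpace ℝ (Fin (N j + 1))}, (∃ j, ‖y j‖ < 1 / 2) →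
      ∃ j, ‖T j (y j)‖ < 1 / 2 := by
    rintro y ⟨j, hj⟩; exact ⟨j, by rwa [(T j).norm_map]⟩
  obtain ⟨u, y, hFz, hGz⟩ := exists_zero_of_equivariant hw hT hFc hGc (c := 4)
    (by
      intro u y a
      by_cases hy : ∀ j, y j ≠ 0
      · simp only [F, hQe _ _ _ hy]
        exact inner_neg_right _ _
      · rw [hF0 _ _ _ (hbz (hTne (hsmall hy))), hF0 _ _ _ (hbz (hsmall hy))]
        exact inner_neg_right _ _)
    (by
      intro u y j
      by_cases hy : ∀ j, y j ≠ 0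
      · simp only [G, hQe _ _ _ hy, (T j).norm_map, map_sub, map_smul, diagInv, hσe, sphMap]
      · rw [hG0 _ _ _ (hbz (hTne (hsmall hy))), hG0 _ _ _ (hbz (hsmall hy)), hσe, map_sub])
    (by
      intro u y j
      by_cases hy : sphereBump y = 0
      · rw [hG0 _ _ _ hy, sub_sub_cancel_left, norm_neg, hσn]; norm_num
      · have hyj : ‖y j‖ ≤ 3 / 2 := by
          by_contra! hj
          exact hy (sphereBump_eq_zero (j := j) (by
            rw [abs_of_pos (by linarith)]; linarith))
        calc ‖G u y j - y j‖ ≤ ‖G u y j‖ + ‖y j‖ := norm_sub_le _ _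
          _ ≤ (‖‖y j‖ • ((Q (Sum.inr j) u y).2 j : EuclideanSpace ℝ (Fin (N j + 1)))‖ +
              ‖σ j (Q (Sum.inr j) u y).1‖) + ‖y j‖ := by gcongr; exact norm_sub_le _ _
          _ = ‖y j‖ + 1 + ‖y j‖ := by rw [norm_smul, norm_norm, norm_coe_sph, hσn, mul_one]
          _ ≤ 4 := by linarith)
  have hy1 : ∀ j, ‖y j‖ = 1 := by
    intro j
    have := congrArg norm (sub_eq_zero.mp (hGz j))
    rwa [norm_smul, norm_norm, norm_coe_sph, hσn, mul_one] at this
  have hQ1 : ∀ a, Q a u y = h (e a) ((u, fun j => radial (y j)), 1) := by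
    intro a; simp only [Q, sphereBump_eq_one hy1]
  obtain ⟨i, hi⟩ := h1 (u, fun j => radial (y j))
  obtain ⟨a, rfl⟩ := hesurj i
  rw [← hQ1] at hi
  rcases a with a | j
  · have hz := hFz a
    simp only [F] at hz
    have hb : inner ℝ ((b (e (Sum.inl a))).1 : EuclideanSpace ℝ (Fin (m + 1)))
        ((b (e (Sum.inl a))).1 : EuclideanSpace ℝ (Fin (m + 1))) = (1 : ℝ) := by
      rw [real_inner_self_eq_norm_sq, norm_coe_sph, one_pow]
    rcases hi with hi | hi
    · rw [hi, hb] at hz; norm_num at hz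
    · rw [hi] at hz
      have h2 : inner ℝ ((b (e (Sum.inl a))).1 : EuclideanSpace ℝ (Fin (m + 1)))
        (-(b (e (Sum.inl a))).1 : EuclideanSpace ℝ (Fin (m + 1))) = (0 : ℝ) := hz
      rw [inner_neg_right, hb] at h2; norm_num at h2
  · have hz := hGz j
    simp only [G, hy1, one_smul] at hz
    rw [sub_eq_zero] at hz
    rcases hi with hi | hi
    · rw [hi] at hz; exact hσ j hz
    · rw [hi] at hz
      have h2 : T j ((b (e (Sum.inr j))).2 j) = σ j (negSph m (b (e (Sum.inr j))).1) := hz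
      rw [hσe] at h2
      exact hσ j ((T j).injective h2)

/-- Equivariant homotopy between maps of spaces with a self-map. -/
def EqHomotopic {Z X : Type*} [TopologicalSpace Z] [TopologicalSpace X] (σ : Z → Z) (τ : X → X)
    (f g : Z → X) : Prop :=
  ∃ H : unitInterval × Z → X, Continuous H ∧ (∀ z, H (0, z) = f z) ∧ (∀ z, H (1, z) = g z) ∧
    ∀ t z, H (t, σ z) = τ (H (t, z))

namespace EqHomotopic

variable {Z X X' : Type*} [TopologicalSpace Z] [TopologicalSpace X] [TopologicalSpace X']
  {σ : Z → Z} {τ : X → X} {τ' : X' → X'}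

theorem trans {f g h : Z → X} (hfg : EqHomotopic σ τ f g) (hgh : EqHomotopic σ τ g h) :
    EqHomotopic σ τ f h := by
  obtain ⟨H, hH, hH0, hH1, hHe⟩ := hfg
  obtain ⟨K, hK, hK0, hK1, hKe⟩ := hgh
  have hf : Continuous f := by
    have : f = fun z => H (0, z) := funext fun z => (hH0 z).symm
    rw [this]; fun_prop
  have hg : Continuous g := by
    have : g = fun z => H (1, z) := funext fun z => (hH1 z).symm
    rw [this]; fun_prop
  have hh : Continuous h := by
    have : h = fun z => K (1, z) := funext fun z => (hK1 z).symm
    rw [this]; fun_prop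
  let H' : ContinuousMap.Homotopy (⟨f, hf⟩ : C(Z, X)) ⟨g, hg⟩ := ⟨⟨H, hH⟩, hH0, hH1⟩
  let K' : ContinuousMap.Homotopy (⟨g, hg⟩ : C(Z, X)) ⟨h, hh⟩ := ⟨⟨K, hK⟩, hK0, hK1⟩
  refine ⟨H'.trans K', (H'.trans K').continuous, (H'.trans K').apply_zero,
    (H'.trans K').apply_one, fun t z => ?_⟩
  rw [ContinuousMap.Homotopy.trans_apply, ContinuousMap.Homotopy.trans_apply]
  split_ifs
  · exact hHe _ z
  · exact hKe _ z

theorem prodMk {f g : Z → X} {f' g' : Z → X'} (h : EqHomotopic σ τ f g)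
    (h' : EqHomotopic σ τ' f' g') :
    EqHomotopic σ (fun x : X × X' => (τ x.1, τ' x.2)) (fun z => (f z, f' z))
      fun z => (g z, g' z) := by
  obtain ⟨H, hH, hH0, hH1, hHe⟩ := h
  obtain ⟨K, hK, hK0, hK1, hKe⟩ := h'
  exact ⟨fun z => (H z, K z), hH.prodMk hK, fun z => by simp only [hH0, hK0],
    fun z => by simp only [hH1, hK1], fun t z => by simp only [hHe, hKe]⟩

theorem pi {J : Type*} {Y : J → Type*} [∀ j, TopologicalSpace (Y j)] {τ : ∀ j, Y j → Y j}
    {f g : Z → ∀ j, Y j}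
    (h : ∀ j, EqHomotopic σ (τ j) (fun z => f z j) fun z => g z j) :
    EqHomotopic σ (fun y j => τ j (y j)) f g := by
  choose H hH hH0 hH1 hHe using h
  exact ⟨fun z j => H j z, continuous_pi hH, fun z => funext fun j => hH0 j z,
    fun z => funext fun j => hH1 j z, fun t z => funext fun j => hHe j t z⟩

theorem comp_left {f g : Z → X} (h : EqHomotopic σ τ f g) {φ : X → X'} (hφ : Continuous φ)
    (hφe : ∀ x, φ (τ x) = τ' (φ x)) : EqHomotopic σ τ' (fun z => φ (f z)) fun z => φ (g z) := by
  obtain ⟨H, hH, hH0, hH1, hHe⟩ := h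
  exact ⟨fun z => φ (H z), hφ.comp hH, fun z => by simp only [hH0],
    fun z => by simp only [hH1], fun t z => by simp only [hHe, hφe]⟩

theorem refl {f : Z → X} (hf : Continuous f) (hfe : ∀ z, f (σ z) = τ (f z)) :
    EqHomotopic σ τ f f :=
  ⟨fun z => f z.2, hf.comp continuous_snd, fun _ => rfl, fun _ => rfl, fun _ z => hfe z⟩

end EqHomotopic

theorem lineMap_ne_zero_of_norm_eq_one {E : Type*} [NormedAddCommGroup E] [NormedSpace ℝ E]
    {a b : E} (ha : ‖a‖ = 1) (hb : ‖b‖ = 1) (hab : a ≠ -b) {t : ℝ} (ht0 : 0 ≤ t) (ht1 : t ≤ 1) :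
    (1 - t) • a + t • b ≠ 0 := by
  intro h
  have h1 := eq_neg_of_add_eq_zero_left h
  have h2 := congrArg norm h1
  rw [norm_neg, norm_smul, norm_smul, ha, hb, mul_one, mul_one, Real.norm_of_nonneg ht0,
    Real.norm_of_nonneg (by linarith)] at h2
  have h3 : t = 1 / 2 := by linarith
  rw [h3, show (1 - 1 / 2 : ℝ) = 1 / 2 by norm_num, ← smul_neg] at h1
  exact hab (smul_right_injective E (by norm_num : (1 / 2 : ℝ) ≠ 0) h1)

theorem radial_coe {n : ℕ} (x : Sph n) : radial (x : EuclideanSpace ℝ (Fin (n + 1))) = x := by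
  refine Subtype.ext ?_
  have := norm_smul_radial (x : EuclideanSpace ℝ (Fin (n + 1)))
  rwa [norm_coe_sph, one_smul] at this

/-- Equivariant maps into a sphere which are nowhere antipodal are equivariantly homotopic. -/
theorem EqHomotopic.of_ne_neg {Z : Type*} [TopologicalSpace Z] {σ : Z → Z} {n : ℕ}
    (T : EuclideanSpace ℝ (Fin (n + 1)) ≃ₗᵢ[ℝ] EuclideanSpace ℝ (Fin (n + 1))) {f g : Z → Sph n}
    (hf : Continuous f) (hg : Continuous g) (hfe : ∀ z, f (σ z) = sphMap T (f z))
    (hge : ∀ z, g (σ z) = sphMap T (g z))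
    (hne : ∀ z, (f z : EuclideanSpace ℝ (Fin (n + 1))) ≠ -g z) :
    EqHomotopic σ (sphMap T) f g := by
  have h0 : ∀ (t : unitInterval) z, (1 - (t : ℝ)) • (f z : EuclideanSpace ℝ (Fin (n + 1))) +
      (t : ℝ) • (g z : EuclideanSpace ℝ (Fin (n + 1))) ≠ 0 := fun t z =>
    lineMap_ne_zero_of_norm_eq_one (norm_coe_sph _) (norm_coe_sph _) (hne z) t.2.1 t.2.2
  refine ⟨fun z => radial ((1 - (z.1 : ℝ)) • (f z.2 : EuclideanSpace ℝ (Fin (n + 1))) +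
      (z.1 : ℝ) • (g z.2 : EuclideanSpace ℝ (Fin (n + 1)))), ?_, fun z => ?_, fun z => ?_,
      fun t z => ?_⟩
  · rw [continuous_iff_continuousAt]
    rintro ⟨t, z⟩
    have hc : Continuous fun z : unitInterval × Z =>
        (1 - (z.1 : ℝ)) • (f z.2 : EuclideanSpace ℝ (Fin (n + 1))) +
          (z.1 : ℝ) • (g z.2 : EuclideanSpace ℝ (Fin (n + 1))) := by fun_prop
    exact ContinuousAt.comp (x := (t, z)) (g := radial) (continuousAt_radial (h0 t z))
      hc.continuousAt
  · simp [radial_coe]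
  · simp [radial_coe]
  · simp only
    rw [← radial_map T (h0 t z), hfe, hge]
    simp [sphMap]

/-- `U` is equivariantly contractible in `X` to the orbit of `b`. -/
def EqContractible {X : Type*} [TopologicalSpace X] (τ : X → X) (b : X) (U : Set X) : Prop :=
  ∃ H : X × unitInterval → X, ContinuousOn H (U ×ˢ univ) ∧ (∀ x ∈ U, H (x, 0) = x) ∧
    (∀ x ∈ U, H (x, 1) = b ∨ H (x, 1) = τ b) ∧ ∀ x ∈ U, ∀ t, H (τ x, t) = τ (H (x, t))

theorem EqContractible.of_eqHomotopic {X : Type*} [TopologicalSpace X] {τ : X → X} {b : X}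
    {U : Set X} (hU : ∀ x ∈ U, τ x ∈ U) {f : U → X} (hf : ∀ x, f x = b ∨ f x = τ b)
    (h : EqHomotopic (fun x : U => (⟨τ x, hU x x.2⟩ : U)) τ Subtype.val f) :
    EqContractible τ b U := by
  classical
  obtain ⟨H, hH, hH0, hH1, hHe⟩ := h
  let K : X × unitInterval → X := fun z => if hz : z.1 ∈ U then H (z.2, ⟨z.1, hz⟩) else z.1
  have hK : ∀ x (hx : x ∈ U) t, K (x, t) = H (t, ⟨x, hx⟩) := fun x hx t => dif_pos hx
  refine ⟨K, ?_, fun x hx => ?_, fun x hx => ?_, fun x hx t => ?_⟩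
  · rw [continuousOn_iff_continuous_domRestrict]
    have hc : Continuous fun z : (U ×ˢ univ : Set (X × unitInterval)) =>
        H (z.1.2, ⟨z.1.1, z.2.1⟩) := by
      refine hH.comp (Continuous.prodMk ?_ ?_)
      · exact continuous_snd.comp continuous_subtype_val
      · exact (continuous_fst.comp continuous_subtype_val).subtype_mk _
    convert hc using 1
    funext z
    exact hK z.1.1 z.2.1 z.1.2
  · rw [hK x hx, hH0]
  · rw [hK x hx, hH1]; exact hf _
  · rw [hK x hx, hK _ (hU x hx), ← hHe]

/-- A disjoint union of open sets contractible to the same orbit is contractible to this orbit. -/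
theorem EqContractible.iUnion {X I : Type*} [TopologicalSpace X] {τ : X → X} {b : X}
    {W : I → Set X} (hWo : ∀ i, IsOpen (W i)) (hWτ : ∀ i, ∀ x ∈ W i, τ x ∈ W i)
    (hd : ∀ i j x, x ∈ W i → x ∈ W j → i = j) (h : ∀ i, EqContractible τ b (W i)) :
    EqContractible τ b (⋃ i, W i) := by
  classical
  choose H hH hH0 hH1 hHe using h
  let K : X × unitInterval → X := fun z => if hz : ∃ i, z.1 ∈ W i then H hz.choose z else z.1
  have hK : ∀ i x, x ∈ W i → ∀ t, K (x, t) = H i (x, t) := by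
    intro i x hx t
    have hz : ∃ i, (x, t).1 ∈ W i := ⟨i, hx⟩
    have h1 : K (x, t) = H hz.choose (x, t) := dif_pos hz
    rw [h1, hd _ _ x hz.choose_spec hx]
  refine ⟨K, ?_, fun x hx => ?_, fun x hx => ?_, fun x hx t => ?_⟩
  · rintro ⟨x, t⟩ ⟨hx, -⟩
    obtain ⟨i, hi⟩ := mem_iUnion.mp hx
    have hmem : (W i ×ˢ univ : Set (X × unitInterval)) ∈ nhds (x, t) :=
      ((hWo i).prod isOpen_univ).mem_nhds ⟨hi, mem_univ _⟩
    refine (((hH i).continuousAt hmem).congr ?_).continuousWithinAt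
    filter_upwards [hmem] with z hz
    exact (hK i z.1 hz.1 z.2).symm
  all_goals obtain ⟨i, hi⟩ := mem_iUnion.mp hx
  · rw [hK i x hi]; exact hH0 i x hi
  · rw [hK i x hi]; exact hH1 i x hi
  · rw [hK i x hi, hK i _ (hWτ i x hi)]; exact hHe i x hi t

theorem HasEqCatCover.of_eqContractible {X : Type*} [TopologicalSpace X] {τ : X → X}
    (hττ : ∀ x, τ (τ x) = x) {k : ℕ} {U : Fin k → Set X} (hUo : ∀ i, IsOpen (U i))
    (hUc : ⋃ i, U i = univ) (hUτ : ∀ i, ∀ x ∈ U i, τ x ∈ U i)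
    (h : ∀ i, ∃ b, EqContractible τ b (U i)) : HasEqCatCover τ k := by
  refine ⟨U, hUo, hUc, fun i => Subset.antisymm (image_subset_iff.mpr (hUτ i))
    fun x hx => ⟨τ x, hUτ i x hx, hττ x⟩, fun i => ?_⟩
  obtain ⟨b, H, hH, hH0, hH1, hHe⟩ := h i
  refine ⟨b, ⟨fun z => H (z.1, z.2), ?_⟩, fun u => hH0 u u.2, fun u => hH1 u u.2,
    fun u hu t => hHe u u.2 t⟩
  exact hH.comp_continuous (by fun_prop) fun z => ⟨z.1.2, mem_univ _⟩

/-- The map equal to `c` where `r` is nonnegative and to `τ c` elsewhere. -/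
noncomputable def signSplit {Z X : Type*} (τ : X → X) (r : Z → ℝ) (c : X) : Z → X := by
  classical
  exact fun z => if 0 ≤ r z then c else τ c

theorem signSplit_of_nonneg {Z X : Type*} (τ : X → X) {r : Z → ℝ} (c : X) {z : Z}
    (hz : 0 ≤ r z) : signSplit τ r c z = c := if_pos hz

theorem signSplit_of_neg {Z X : Type*} (τ : X → X) {r : Z → ℝ} (c : X) {z : Z}
    (hz : r z < 0) : signSplit τ r c z = τ c := if_neg (not_le.mpr hz)

theorem continuous_signSplit {Z X : Type*} [TopologicalSpace Z] [TopologicalSpace X] (τ : X → X)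
    {r : Z → ℝ} (hr : Continuous r) (hr0 : ∀ z, r z ≠ 0) (c : X) :
    Continuous (signSplit τ r c) := by
  classical
  unfold signSplit
  exact Continuous.if_le continuous_const continuous_const continuous_const hr
    fun z hz => absurd hz.symm (hr0 z)

theorem signSplit_map {Z X : Type*} {σ : Z → Z} {τ : X → X} (hττ : ∀ x, τ (τ x) = x) {r : Z → ℝ}
    (hr0 : ∀ z, r z ≠ 0) (hrσ : ∀ z, r (σ z) = -r z) (c : X) (z : Z) :
    signSplit τ r c (σ z) = τ (signSplit τ r c z) := by
  rcases lt_or_gt_of_ne (hr0 z) with h | h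
  · rw [signSplit_of_nonneg τ c (by rw [hrσ]; linarith), signSplit_of_neg τ c h, hττ]
  · rw [signSplit_of_neg τ c (by rw [hrσ]; linarith), signSplit_of_nonneg τ c h.le]

theorem EqHomotopic.signSplit {Z X : Type*} [TopologicalSpace Z] [TopologicalSpace X] {σ : Z → Z}
    {τ : X → X} (hτ : Continuous τ) (hττ : ∀ x, τ (τ x) = x) {r : Z → ℝ} (hr : Continuous r)
    (hr0 : ∀ z, r z ≠ 0) (hrσ : ∀ z, r (σ z) = -r z) {c c' : X} (γ : Path c c') :
    EqHomotopic σ τ (signSplit τ r c) (signSplit τ r c') := by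
  classical
  refine ⟨fun z => Paper.signSplit τ r (γ z.1) z.2, ?_, fun z => by simp only [γ.source],
    fun z => by simp only [γ.target], fun t z => Paper.signSplit_map hττ hr0 hrσ (γ t) z⟩
  unfold Paper.signSplit
  exact Continuous.if_le (by fun_prop) (by fun_prop) continuous_const (hr.comp continuous_snd)
    fun z hz => absurd hz.symm (hr0 z.2)

/-- The functions comparing the coordinates of `u` and the distances from `y j` to `-s j u`. -/
noncomputable def blockFun {m : ℕ} {J : Type*} {N : J → ℕ} (s : ∀ j, Sph m → Sph (N j))
    (x : Sph m × ∀ j, Sph (N j)) : Fin (m + 1) ⊕ J → ℝ :=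
  Sum.elim (fun i => |x.1.1 i|) fun j => ‖(x.1.1.ofLp : Fin (m + 1) → ℝ)‖ *
    ((1 + inner ℝ (x.2 j : EuclideanSpace ℝ (Fin (N j + 1))) (s j x.1)) / 2)

section BlockFun

variable {m : ℕ} {J : Type*} {N : J → ℕ} {s : ∀ j, Sph m → Sph (N j)}

theorem continuous_blockFun (hs : ∀ j, Continuous (s j)) : Continuous (blockFun s) := by
  refine continuous_pi ?_
  rintro (i | j)
  · simp only [blockFun, Sum.elim_inl]
    fun_prop
  · simp only [blockFun, Sum.elim_inr]
    fun_prop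

theorem blockFun_diagInv
    {T : ∀ j, EuclideanSpace ℝ (Fin (N j + 1)) ≃ₗᵢ[ℝ] EuclideanSpace ℝ (Fin (N j + 1))}
    (hse : ∀ j u, s j (negSph m u) = sphMap (T j) (s j u)) (x : Sph m × ∀ j, Sph (N j)) :
    blockFun s (diagInv T x) = blockFun s x := by
  funext l
  rcases l with i | j
  · exact abs_neg _
  · have h1 : ‖((negSph m x.1).1.ofLp : Fin (m + 1) → ℝ)‖ =
        ‖(x.1.1.ofLp : Fin (m + 1) → ℝ)‖ := norm_neg (x.1.1.ofLp : Fin (m + 1) → ℝ)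
    have h2 : inner ℝ (sphMap (T j) (x.2 j) : EuclideanSpace ℝ (Fin (N j + 1)))
        (sphMap (T j) (s j x.1)) =
        inner ℝ (x.2 j : EuclideanSpace ℝ (Fin (N j + 1))) (s j x.1) :=
      (T j).inner_map_map _ _
    simp only [blockFun, Sum.elim_inr, diagInv, hse, h1, h2]

theorem exists_blockFun_inl_eq (x : Sph m × ∀ j, Sph (N j)) :
    ∃ i, blockFun s x (Sum.inl i) = ‖(x.1.1.ofLp : Fin (m + 1) → ℝ)‖ := by
  obtain ⟨i, hi⟩ := Finite.exists_max fun i => |x.1.1 i|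
  refine ⟨i, le_antisymm (norm_le_pi_norm (x.1.1.ofLp : Fin (m + 1) → ℝ) i) ?_⟩
  exact (pi_norm_le_iff_of_nonneg (abs_nonneg _)).mpr hi

theorem norm_ofLp_pos (u : Sph m) : 0 < ‖(u.1.ofLp : Fin (m + 1) → ℝ)‖ := by
  rw [norm_pos_iff]
  intro h
  have h1 : u.1 = 0 := PiLp.ext fun i => congrFun h i
  have h2 := norm_coe_sph u
  rw [h1, norm_zero] at h2
  exact zero_ne_one h2

theorem blockFun_le (x : Sph m × ∀ j, Sph (N j)) (l : Fin (m + 1) ⊕ J) :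
    blockFun s x l ≤ ‖(x.1.1.ofLp : Fin (m + 1) → ℝ)‖ := by
  rcases l with i | j
  · exact norm_le_pi_norm (x.1.1.ofLp : Fin (m + 1) → ℝ) i
  · refine mul_le_of_le_one_right (norm_nonneg _) ?_
    have := real_inner_le_norm (x.2 j : EuclideanSpace ℝ (Fin (N j + 1))) (s j x.1)
    rw [norm_coe_sph, norm_coe_sph] at this
    linarith

theorem blockFun_inr_of_eq {x : Sph m × ∀ j, Sph (N j)} {j : J} (h : x.2 j = s j x.1) :
    blockFun s x (Sum.inr j) = ‖(x.1.1.ofLp : Fin (m + 1) → ℝ)‖ := by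
  simp only [blockFun, Sum.elim_inr, h, real_inner_self_eq_norm_sq, norm_coe_sph]
  norm_num

theorem blockFun_inr_of_eq_neg {x : Sph m × ∀ j, Sph (N j)} {j : J}
    (h : (x.2 j : EuclideanSpace ℝ (Fin (N j + 1))) = -s j x.1) :
    blockFun s x (Sum.inr j) = 0 := by
  simp only [blockFun, Sum.elim_inr, h, inner_neg_left, real_inner_self_eq_norm_sq, norm_coe_sph]
  norm_num

end BlockFun

/-- The points where the functions `f l`, `l ∈ S`, are positive and dominate the others. -/
def dominated {X L : Type*} (f : X → L → ℝ) (S : Finset L) : Set X :=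
  {x | (∀ l ∈ S, 0 < f x l) ∧ ∀ l ∈ S, ∀ k ∉ S, f x k < f x l}

theorem isOpen_dominated {X L : Type*} [TopologicalSpace X] [Finite L] {f : X → L → ℝ}
    (hf : Continuous f) (S : Finset L) : IsOpen (dominated f S) := by
  have hl : ∀ l, Continuous fun x => f x l := fun l => (continuous_apply l).comp hf
  have h : dominated f S = (⋂ l ∈ S, {x | 0 < f x l}) ∩
      ⋂ l ∈ S, ⋂ k, ⋂ _ : k ∉ S, {x | f x k < f x l} := by
    ext x
    simp [dominated]
  rw [h]
  refine IsOpen.inter ?_ ?_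
  · exact isOpen_iInter_of_finite fun l => isOpen_iInter_of_finite fun _ =>
      isOpen_lt continuous_const (hl l)
  · exact isOpen_iInter_of_finite fun l => isOpen_iInter_of_finite fun _ =>
      isOpen_iInter_of_finite fun k => isOpen_iInter_of_finite fun _ => isOpen_lt (hl k) (hl l)

theorem eq_of_mem_dominated {X L : Type*} {f : X → L → ℝ} {S S' : Finset L}
    (hc : S.card = S'.card) {x : X} (h : x ∈ dominated f S) (h' : x ∈ dominated f S') :
    S = S' := by
  by_contra hne
  obtain ⟨l, hl, hlS⟩ := Finset.not_subset.mp fun hs =>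
    hne (Finset.eq_of_subset_of_card_le hs hc.symm.le)
  obtain ⟨k, hk', hk⟩ := Finset.not_subset.mp fun hs =>
    hne (Finset.eq_of_subset_of_card_le hs hc.le).symm
  exact lt_asymm (h.2 l hl k hk) (h'.2 k hk' l hlS)

/-- The sets on which a given nonempty set of functions dominates are equivariantly
contractible to any orbit. -/
theorem eqContractible_dominated {m : ℕ} {J : Type*} [Finite J] {N : J → ℕ}
    [PathConnectedSpace (Sph m × ∀ j, Sph (N j))]
    {T : ∀ j, EuclideanSpace ℝ (Fin (N j + 1)) ≃ₗᵢ[ℝ] EuclideanSpace ℝ (Fin (N j + 1))}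
    (hT : ∀ j y, T j (T j y) = y) {s : ∀ j, Sph m → Sph (N j)} (hs : ∀ j, Continuous (s j))
    (hse : ∀ j u, s j (negSph m u) = sphMap (T j) (s j u)) (b : Sph m × ∀ j, Sph (N j))
    {S : Finset (Fin (m + 1) ⊕ J)} (hS : S.Nonempty) :
    EqContractible (diagInv T) b (dominated (blockFun s) S) := by
  classical
  set W := dominated (blockFun s) S with hWdef
  have hW : ∀ x ∈ W, diagInv T x ∈ W := by
    intro x hx
    rw [hWdef, dominated, mem_ofPred_eq, blockFun_diagInv hse]
    exact hx
  by_cases hi : ∃ i, Sum.inl i ∈ S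
  swap
  · have hemp : ∀ x, x ∉ W := by
      intro x hx
      obtain ⟨l, hl⟩ := hS
      obtain ⟨i, hi'⟩ := exists_blockFun_inl_eq (s := s) x
      have := hx.2 l hl (Sum.inl i) fun h => hi ⟨i, h⟩
      rw [hi'] at this
      exact absurd (blockFun_le x l) (not_le.mpr this)
    have hWe : W = ∅ := eq_empty_of_forall_notMem hemp
    exact ⟨fun z => z.1, continuous_fst.continuousOn, fun x _ => rfl,
      fun x hx => absurd hx (hemp x), fun x hx => absurd hx (hemp x)⟩
  obtain ⟨i, hi⟩ := hi
  let σ : W → W := fun x => ⟨diagInv T x, hW x x.2⟩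
  let r : W → ℝ := fun x => x.1.1.1 i
  have hr : Continuous r := by fun_prop
  have hr0 : ∀ x, r x ≠ 0 := fun x => abs_pos.mp (x.2.1 (Sum.inl i) hi)
  have hrσ : ∀ x, r (σ x) = -r x := fun x => rfl
  -- the nearest of the two sections
  obtain ⟨s', hs', hse', hne⟩ : ∃ s' : ∀ j, Sph m → Sph (N j), (∀ j, Continuous (s' j)) ∧
      (∀ j u, s' j (negSph m u) = sphMap (T j) (s' j u)) ∧
      ∀ x ∈ W, ∀ j, (x.2 j : EuclideanSpace ℝ (Fin (N j + 1))) ≠ -s' j x.1 := by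
    have : ∀ j, ∃ s' : Sph m → Sph (N j), Continuous s' ∧
      (∀ u, s' (negSph m u) = sphMap (T j) (s' u)) ∧
      ∀ x ∈ W, (x.2 j : EuclideanSpace ℝ (Fin (N j + 1))) ≠ -s' x.1 := by
      intro j
      by_cases hj : Sum.inr j ∈ S
      · refine ⟨s j, hs j, hse j, fun x hx h => ?_⟩
        exact (hx.1 _ hj).ne' (blockFun_inr_of_eq_neg h)
      · refine ⟨fun u => negSph _ (s j u), (continuous_negSph _).comp (hs j), fun u => ?_,
          fun x hx h => ?_⟩
        · simp only [hse]
          exact Subtype.ext (map_neg (T j) _).symm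
        · have h' : x.2 j = s j x.1 := Subtype.ext (h.trans (neg_neg _))
          have h2 := hx.2 _ hi _ hj
          rw [blockFun_inr_of_eq h'] at h2
          exact absurd (blockFun_le x _) (not_le.mpr h2)
    choose s' h1 h2 h3 using this
    exact ⟨s', h1, h2, fun x hx j => h3 j x hx⟩
  let φ : Sph m → Sph m × ∀ j, Sph (N j) := fun u => (u, fun j => s' j u)
  have hφ : Continuous φ := continuous_id.prodMk (continuous_pi hs')
  have hφe : ∀ u, φ (negSph m u) = diagInv T (φ u) := fun u =>
    Prod.ext rfl (funext fun j => hse' j u)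
  let e : Sph m := ⟨EuclideanSpace.single i 1, by simp⟩
  have hfst : Continuous fun x : W => x.1.1 := continuous_fst.comp continuous_subtype_val
  have h1 : EqHomotopic σ (diagInv T) Subtype.val fun x => φ x.1.1 := by
    refine EqHomotopic.prodMk (τ := negSph m) (f := fun x : W => x.1.1) (g := fun x : W => x.1.1)
      (EqHomotopic.refl hfst fun x => rfl)
      (EqHomotopic.pi (τ := fun j => sphMap (T j)) fun j => ?_)
    refine EqHomotopic.of_ne_neg (T j) ?_ ((hs' j).comp hfst) (fun x => rfl)
      (fun x => hse' j x.1.1) fun x => hne x.1 x.2 j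
    exact (continuous_apply j).comp (continuous_snd.comp continuous_subtype_val)
  have h2 : EqHomotopic σ (negSph m) (fun x => x.1.1) (signSplit (negSph m) r e) := by
    refine EqHomotopic.of_ne_neg (LinearIsometryEquiv.neg ℝ) hfst
      (continuous_signSplit _ hr hr0 e) (fun x => rfl)
      (signSplit_map (fun x => Subtype.ext (neg_neg _)) hr0 hrσ e) fun x hx => ?_
    have hxi : r x = -((signSplit (negSph m) r e x : Sph m) : EuclideanSpace ℝ (Fin (m + 1))) i :=
      congrArg (fun v : EuclideanSpace ℝ (Fin (m + 1)) => v i) hx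
    rcases lt_or_gt_of_ne (hr0 x) with h | h
    · rw [signSplit_of_neg _ _ h] at hxi
      simp [e, negSph] at hxi
      linarith
    · rw [signSplit_of_nonneg _ _ h.le] at hxi
      simp [e] at hxi
      linarith
  have h3 : EqHomotopic σ (diagInv T) (fun x => φ x.1.1) (signSplit (diagInv T) r (φ e)) := by
    have := h2.comp_left (τ' := diagInv T) hφ hφe
    convert this using 1
    funext x
    rcases lt_or_gt_of_ne (hr0 x) with h | h
    · rw [signSplit_of_neg _ _ h, signSplit_of_neg _ _ h, hφe]
    · rw [signSplit_of_nonneg _ _ h.le, signSplit_of_nonneg _ _ h.le]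
  have h4 := EqHomotopic.signSplit (σ := σ) (continuous_diagInv T) (diagInv_diagInv hT) hr hr0 hrσ
    (PathConnectedSpace.somePath (φ e) b)
  refine EqContractible.of_eqHomotopic hW (fun x => ?_) (h1.trans (h3.trans h4))
  rcases lt_or_gt_of_ne (hr0 x) with h | h
  · exact Or.inr (signSplit_of_neg _ _ h)
  · exact Or.inl (signSplit_of_nonneg _ _ h.le)

/-- The upper bound for the size of an equivariant categorical cover. -/
theorem hasEqCatCover_diagInv {m : ℕ} {J : Type*} [Fintype J] {N : J → ℕ}
    [PathConnectedSpace (Sph m × ∀ j, Sph (N j))]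
    {T : ∀ j, EuclideanSpace ℝ (Fin (N j + 1)) ≃ₗᵢ[ℝ] EuclideanSpace ℝ (Fin (N j + 1))}
    (hT : ∀ j y, T j (T j y) = y) {s : ∀ j, Sph m → Sph (N j)} (hs : ∀ j, Continuous (s j))
    (hse : ∀ j u, s j (negSph m u) = sphMap (T j) (s j u)) :
    HasEqCatCover (diagInv (m := m) T) (m + Fintype.card J + 1) := by
  classical
  have hW : ∀ S, ∀ x ∈ dominated (blockFun s) S, diagInv T x ∈ dominated (blockFun s) S := by
    intro S x hx
    rw [dominated, mem_ofPred_eq, blockFun_diagInv hse]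
    exact hx
  have hWo := isOpen_dominated (continuous_blockFun hs)
  refine HasEqCatCover.of_eqContractible (diagInv_diagInv hT)
    (U := fun c => ⋃ S : {S : Finset (Fin (m + 1) ⊕ J) // S.card = c + 1},
      dominated (blockFun s) S.1) (fun c => isOpen_iUnion fun S => hWo S.1) ?_ ?_ fun c => ?_
  · refine eq_univ_of_forall fun x => ?_
    set M := ‖(x.1.1.ofLp : Fin (m + 1) → ℝ)‖
    set S := Finset.univ.filter fun l => blockFun s x l = M with hSdef
    obtain ⟨i, hi⟩ := exists_blockFun_inl_eq (s := s) x
    have hpos : 0 < S.card := Finset.card_pos.mpr ⟨Sum.inl i, by simpa [hSdef] using hi⟩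
    have hle : S.card ≤ m + Fintype.card J + 1 := by
      refine (Finset.card_le_univ S).trans (le_of_eq ?_)
      simp; omega
    refine mem_iUnion.mpr ⟨⟨S.card - 1, by omega⟩, mem_iUnion.mpr ⟨⟨S, ?_⟩, ?_, ?_⟩⟩
    · simp only; omega
    · intro l hl
      have : blockFun s x l = M := (Finset.mem_filter.mp hl).2
      rw [this]; exact norm_ofLp_pos x.1
    · intro l hl k hk
      have : blockFun s x l = M := (Finset.mem_filter.mp hl).2
      rw [this]
      exact lt_of_le_of_ne (blockFun_le x k) fun h =>
        hk (Finset.mem_filter.mpr ⟨Finset.mem_univ k, h⟩)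
  · intro c x hx
    obtain ⟨S, hS⟩ := mem_iUnion.mp hx
    exact mem_iUnion.mpr ⟨S, hW _ x hS⟩
  · obtain ⟨b⟩ : Nonempty (Sph m × ∀ j, Sph (N j)) := PathConnectedSpace.nonempty
    refine ⟨b, EqContractible.iUnion (fun S => hWo S.1) (fun S => hW S.1)
      (fun S S' x hx hx' => Subtype.ext (eq_of_mem_dominated (S.2.trans S'.2.symm) hx hx'))
      fun S => eqContractible_dominated hT hs hse b (Finset.card_pos.mp ?_)⟩
    rw [S.2]; omega

/-- Equivariant categorical covers transport along equivariant homeomorphisms. -/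
theorem HasEqCatCover.of_homeomorph {X Y : Type*} [TopologicalSpace X] [TopologicalSpace Y]
    {τ : X → X} {τ' : Y → Y} (e : X ≃ₜ Y) (he : ∀ x, e (τ x) = τ' (e x)) {k : ℕ}
    (h : HasEqCatCover τ k) : HasEqCatCover τ' k := by
  obtain ⟨U, hUo, hUc, hUi, hU⟩ := h
  have he' : ∀ y, e.symm (τ' y) = τ (e.symm y) := fun y => by
    rw [e.symm_apply_eq, he, e.apply_symm_apply]
  refine ⟨fun i => e.symm ⁻¹' U i, fun i => (hUo i).preimage e.symm.continuous, ?_, fun i => ?_,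
    fun i => ?_⟩
  · rw [← preimage_iUnion, hUc, preimage_univ]
  · ext y
    constructor
    · rintro ⟨x, hx, rfl⟩
      change e.symm (τ' x) ∈ U i
      rw [he', ← hUi i]
      exact mem_image_of_mem τ hx
    · intro hy
      change e.symm y ∈ U i at hy
      rw [← hUi i] at hy
      obtain ⟨x, hx, hxy⟩ := hy
      refine ⟨e x, ?_, ?_⟩
      · change e.symm (e x) ∈ U i
        rwa [e.symm_apply_apply]
      · rw [← he, hxy, e.apply_symm_apply]
  · obtain ⟨b, H, h0, h1, hH⟩ := hU i
    refine ⟨e b, ⟨fun q => e (H (⟨e.symm q.1, q.1.2⟩, q.2)), by fun_prop⟩, fun u => ?_,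
      fun u => ?_, fun u hu t => ?_⟩
    · change e (H (⟨e.symm u, u.2⟩, 0)) = u
      rw [h0]
      exact e.apply_symm_apply u
    · change e (H (⟨e.symm u, u.2⟩, 1)) ∈ ({e b, τ' (e b)} : Set Y)
      rcases h1 ⟨e.symm u, u.2⟩ with h | h
      · exact Or.inl (congrArg e h)
      · exact Or.inr ((congrArg e h).trans (he b))
    · change e (H (⟨e.symm (τ' u), hu⟩, t)) = τ' (e (H (⟨e.symm u, u.2⟩, t)))
      have hu' : τ (e.symm u) ∈ U i := he' u ▸ hu
      rw [← he, ← hH ⟨e.symm u, u.2⟩ hu' t]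
      congr 3
      exact Subtype.ext (he' u)

theorem pathConnectedSpace_sph {n : ℕ} (hn : 1 ≤ n) : PathConnectedSpace (Sph n) := by
  refine isPathConnected_iff_pathConnectedSpace.mp (isPathConnected_sphere ?_ 0 zero_le_one)
  rw [← Module.finrank_eq_rank, finrank_euclideanSpace_fin]
  exact_mod_cast Nat.lt_succ_of_le hn

theorem tauLin_apply (n p : ℕ) (y : EuclideanSpace ℝ (Fin (n + 1))) (k : Fin (n + 1)) :
    tauLin n p y k = (-1) ^ (if (k : ℕ) < p then 2 else 1) * y k := by
  by_cases h : (k : ℕ) < p <;> simp [tauLin, h]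

/-- There is an equivariant map between antipodal spheres of nondecreasing dimensions. -/
theorem exists_sph_inclusion {a b : ℕ} (h : a ≤ b) :
    ∃ s : Sph a → Sph b, Continuous s ∧ ∀ u, s (negSph a u) = negSph b (s u) := by
  obtain ⟨d, rfl⟩ := Nat.exists_eq_add_of_le h
  let f : EuclideanSpace ℝ (Fin (a + 1)) → EuclideanSpace ℝ (Fin (a + d + 1)) := fun y =>
    WithLp.toLp 2 fun k => if hk : (k : ℕ) < a + 1 then y ⟨k, hk⟩ else 0
  have hf : Continuous f := by
    refine (PiLp.continuous_toLp 2 _).comp (continuous_pi fun k => ?_)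
    by_cases hk : (k : ℕ) < a + 1 <;> simp only [hk, dite_true, dite_false] <;> fun_prop
  have hneg : ∀ y, f (-y) = -f y := fun y => by
    ext k
    change (if hk : (k : ℕ) < a + 1 then -y ⟨k, hk⟩ else 0) =
      -(if hk : (k : ℕ) < a + 1 then y ⟨k, hk⟩ else 0)
    split_ifs
    · rfl
    · exact neg_zero.symm
  have hnorm : ∀ y, ‖f y‖ = ‖y‖ := fun y => by
    rw [EuclideanSpace.norm_eq, EuclideanSpace.norm_eq]
    congr 1
    have hc : a + 1 + d = a + d + 1 := by omega
    rw [← Equiv.sum_comp (finCongr hc), Fin.sum_univ_add]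
    have h1 : ∀ i : Fin (a + 1), f y (finCongr hc (Fin.castAdd d i)) = y i := fun i =>
      dif_pos i.2
    have h2 : ∀ i : Fin d, f y (finCongr hc (Fin.natAdd (a + 1) i)) = 0 := fun i =>
      dif_neg (not_lt.mpr (Nat.le_add_right (a + 1) i))
    simp [h1, h2]
  have hsph : ∀ u : Sph a, f u ∈ Metric.sphere 0 1 := fun u => by
    rw [mem_sphere_zero_iff_norm, hnorm]
    exact norm_coe_sph u
  exact ⟨fun u => ⟨f u, hsph u⟩, (hf.comp continuous_subtype_val).subtype_mk hsph,
    fun u => Subtype.ext (hneg u)⟩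

/-- There is an equivariant map from an antipodal sphere to a sphere whose involution fixes a
point. -/
theorem exists_sph_to_tauSph (a n : ℕ) {p : ℕ} (hp : 1 ≤ p) :
    ∃ s : Sph a → Sph n, Continuous s ∧ ∀ u, s (negSph a u) = tauSph n p (s u) := by
  refine ⟨fun _ => ⟨EuclideanSpace.single 0 1, by simp⟩, continuous_const, fun _ => ?_⟩
  refine Subtype.ext (PiLp.ext fun k => ?_)
  change EuclideanSpace.single (0 : Fin (n + 1)) (1 : ℝ) k =
    tauLin n p (EuclideanSpace.single 0 1) k
  rw [tauLin_apply]
  by_cases hk : k = 0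
  · subst hk
    simp [Nat.lt_of_succ_le hp]
  · simp [hk]

/-- The dimensions of the spheres other than the first antipodal one. -/
def factorDim {r l : ℕ} (n : Fin r → ℕ) (m : Fin (l + 1) → ℕ) : Fin r ⊕ Fin l → ℕ :=
  Sum.elim n fun j => m j.succ

/-- The involutions of the spheres other than the first antipodal one. -/
noncomputable def factorInv {r l : ℕ} (n p : Fin r → ℕ) (m : Fin (l + 1) → ℕ) :
    ∀ j, EuclideanSpace ℝ (Fin (factorDim n m j + 1)) ≃ₗᵢ[ℝ]
      EuclideanSpace ℝ (Fin (factorDim n m j + 1))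
  | .inl i => tauLin (n i) (p i)
  | .inr _ => LinearIsometryEquiv.neg ℝ

/-- The weights of the coordinates under the involutions `factorInv`. -/
def factorWeight {r l : ℕ} (n p : Fin r → ℕ) (m : Fin (l + 1) → ℕ) :
    ∀ j, Fin (factorDim n m j + 1) → ℕ
  | .inl i => fun k => if (k : ℕ) < p i then 2 else 1
  | .inr _ => fun _ => 1

theorem factorWeight_ne_zero {r l : ℕ} (n p : Fin r → ℕ) (m : Fin (l + 1) → ℕ) :
    ∀ j k, factorWeight n p m j k ≠ 0
  | .inl i, k => by
    change (if (k : ℕ) < p i then 2 else 1) ≠ 0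
    split_ifs <;> simp
  | .inr _, _ => one_ne_zero

theorem factorInv_apply {r l : ℕ} (n p : Fin r → ℕ) (m : Fin (l + 1) → ℕ) :
    ∀ j y k, factorInv n p m j y k = (-1) ^ factorWeight n p m j k * y k
  | .inl i, y, k => tauLin_apply (n i) (p i) y k
  | .inr j, y, k => by
    change -y k = (-1) ^ 1 * y k
    ring

theorem exists_factor_section {r l : ℕ} {n p : Fin r → ℕ} (hp : ∀ i, 1 ≤ p i)
    {m : Fin (l + 1) → ℕ} (hm : Monotone m) :
    ∀ j, ∃ s : Sph (m 0) → Sph (factorDim n m j), Continuous s ∧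
      ∀ u, s (negSph (m 0) u) = sphMap (factorInv n p m j) (s u)
  | .inl i => exists_sph_to_tauSph (m 0) (n i) (hp i)
  | .inr j => exists_sph_inclusion (hm (Fin.zero_le j.succ))

/-- The product of all spheres, with the first antipodal factor singled out. -/
def factorHomeomorph {r l : ℕ} (n : Fin r → ℕ) (m : Fin (l + 1) → ℕ) :
    (Sph (m 0) × ∀ j, Sph (factorDim n m j)) ≃ₜ
      (∀ i, Sph (n i)) × ∀ j, Sph (m j) where
  toFun x := (fun i => x.2 (.inl i), Fin.cons x.1 fun j => x.2 (.inr j))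
  invFun z := (z.2 0, fun j => match j with
    | .inl i => z.1 i
    | .inr j => z.2 j.succ)
  left_inv x := by
    refine Prod.ext rfl (funext ?_)
    rintro (i | j) <;> rfl
  right_inv z := Prod.ext rfl (Fin.cons_self_tail z.2)
  continuous_toFun := by
    refine (continuous_pi fun i => (continuous_apply _).comp continuous_snd).prodMk
      (continuous_pi fun j => ?_)
    refine Fin.cases ?_ (fun j => ?_) j
    · exact continuous_fst
    · exact (continuous_apply (Sum.inr j)).comp continuous_snd
  continuous_invFun := by
    refine ((continuous_apply _).comp continuous_snd).prodMk (continuous_pi ?_)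
    rintro (i | j)
    · exact (continuous_apply i).comp continuous_fst
    · exact (continuous_apply j.succ).comp continuous_snd

theorem factorHomeomorph_diagInv {r l : ℕ} (n p : Fin r → ℕ) (m : Fin (l + 1) → ℕ)
    (x : Sph (m 0) × ∀ j, Sph (factorDim n m j)) :
    factorHomeomorph n m (diagInv (factorInv n p m) x) =
      ((fun i => tauSph (n i) (p i) ((factorHomeomorph n m x).1 i)),
        fun j => negSph (m j) ((factorHomeomorph n m x).2 j)) := by
  refine Prod.ext rfl (funext fun j => ?_)
  refine Fin.cases ?_ (fun j => ?_) j <;> rfl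

/-- **Equivariant LS-category of a product of spheres.**  Let `m_1 ≤ ⋯ ≤ m_ℓ` and
`n_1, …, n_r` be positive integers with `1 ≤ p_i ≤ n_i`, and let `ℤ/2` act on
`S^{n_1} × ⋯ × S^{n_r} × S^{m_1} × ⋯ × S^{m_ℓ}` by the free involution acting as
`τ_{n_i,p_i}` on `S^{n_i}` and antipodally on each `S^{m_j}`.  Then the equivariant
LS-category of this product equals `m_1 + ℓ + r`. -/
theorem eqcat_spheres_spheres (r ℓ : ℕ) (hℓ : 0 < ℓ)
    (n p : Fin r → ℕ) (hn : ∀ i, 1 ≤ n i) (hp1 : ∀ i, 1 ≤ p i) (hpn : ∀ i, p i ≤ n i)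
    (m : Fin ℓ → ℕ) (hm : ∀ j, 1 ≤ m j) (hmono : Monotone m) :
    eqCat (fun z : (∀ i : Fin r, Sph (n i)) × (∀ j : Fin ℓ, Sph (m j)) =>
        ((fun i => tauSph (n i) (p i) (z.1 i)), fun j => negSph (m j) (z.2 j))) =
      (m ⟨0, hℓ⟩ + ℓ + r : ℕ) := by
  obtain ⟨l, rfl⟩ := Nat.exists_eq_succ_of_ne_zero hℓ.ne'
  have hcard : m 0 + Fintype.card (Fin r ⊕ Fin l) + 1 = m ⟨0, hℓ⟩ + (l + 1) + r := by
    have : m ⟨0, hℓ⟩ = m 0 := rfl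
    simp only [Fintype.card_sum, Fintype.card_fin]
    omega
  choose s hs hse using exists_factor_section (n := n) hp1 hmono
  have hT : ∀ j y, factorInv n p m j (factorInv n p m j y) = y := fun j y =>
    PiLp.ext fun k => by
      rw [factorInv_apply, factorInv_apply, ← mul_assoc, ← mul_pow]
      norm_num
  have : PathConnectedSpace (Sph (m 0)) := pathConnectedSpace_sph (hm 0)
  have : ∀ j, PathConnectedSpace (Sph (factorDim n m j)) := by
    rintro (i | j)
    · exact pathConnectedSpace_sph (hn i)
    · exact pathConnectedSpace_sph (hm j.succ)
  refine le_antisymm (sInf_le ⟨_, rfl, ?_⟩) (le_sInf ?_)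
  · rw [← hcard]
    exact (hasEqCatCover_diagInv hT hs hse).of_homeomorph (factorHomeomorph n m)
      (factorHomeomorph_diagInv n p m)
  · rintro _ ⟨k, rfl, hk⟩
    rw [← hcard]
    refine Nat.cast_le.mpr (HasEqCatCover.le_of_sections (factorWeight_ne_zero n p m)
      (factorInv_apply n p m) hs hse (hk.of_homeomorph (factorHomeomorph n m).symm fun z => ?_))
    rw [Homeomorph.symm_apply_eq, factorHomeomorph_diagInv, Homeomorph.apply_symm_apply]

end Paper
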